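/- arXiv:2603.11038 — 2 statements merged into one kernel-verified Lean document; each statement's English description precedes it below -/
import Mathlib

section
/- For every integer d ≥ 0 there exists a constant C_d (depending only on d) such that for every field F, every n ≥ 1, and every M_d-matrix M over F, the partition rank satisfies PR(M) ≤ C_d · CR(M). -/
open MvPolynomial

section Defs

variable {F : Type*} [Field F]

/-- A polynomial in the block variables `x_{i,j}` (`i ∈ Fin d`, `j ∈ Fin n`) is
multilinear exactly in the blocks of `S`: every monomial has degree 1 in each block
`i ∈ S` and degree 0 in each block `i ∉ S`. -/
def IsMultilinearOn {d n : ℕ} (S : Finset (Fin d))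
    (f : MvPolynomial (Fin d × Fin n) F) : Prop :=
  ∀ m ∈ f.support, ∀ i : Fin d,
    (∑ j : Fin n, m (i, j)) = if i ∈ S then 1 else 0

/-- A multilinear form: degree 1 in every block of variables. -/
def IsMultilinear {d n : ℕ} (f : MvPolynomial (Fin d × Fin n) F) : Prop :=
  IsMultilinearOn Finset.univ f

/-- Commutative rank: the rank of the matrix over the field of fractions of the
polynomial ring. -/
noncomputable def CR {σ : Type*} {α β : Type*} [Fintype β]
    (M : Matrix α β (MvPolynomial σ F)) : ℕ :=
  (M.map (algebraMap (MvPolynomial σ F) (FractionRing (MvPolynomial σ F)))).rank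

/-- `M` is the sum of `r` outer products `u ⊗ v`, where `u` has entries multilinear
in the blocks of some `S ⊆ [d]` and `v` has entries multilinear in the complementary
blocks. -/
def HasPRDecomp {d n a b : ℕ}
    (M : Matrix (Fin a) (Fin b) (MvPolynomial (Fin d × Fin n) F)) (r : ℕ) : Prop :=
  ∃ (S : Fin r → Finset (Fin d))
    (u : Fin r → Fin a → MvPolynomial (Fin d × Fin n) F)
    (v : Fin r → Fin b → MvPolynomial (Fin d × Fin n) F),
    (∀ t i, IsMultilinearOn (S t) (u t i)) ∧
    (∀ t j, IsMultilinearOn (S t)ᶜ (v t j)) ∧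
    M = ∑ t, Matrix.of fun i j => u t i * v t j

/-- Partition rank of a matrix of multilinear forms. -/
noncomputable def PR {d n a b : ℕ}
    (M : Matrix (Fin a) (Fin b) (MvPolynomial (Fin d × Fin n) F)) : ℕ :=
  sInf {r | HasPRDecomp M r}

/-- Evaluation of a matrix of multilinear forms at a point `p ∈ (F^n)^d`. -/
noncomputable def evalMat {d n : ℕ} {α β : Type*}
    (M : Matrix α β (MvPolynomial (Fin d × Fin n) F)) (p : Fin d → Fin n → F) :
    Matrix α β F :=
  M.map (eval fun v => p v.1 v.2)

/-- Max-rank: the largest rank of a scalar evaluation. -/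
noncomputable def MaxR {d n : ℕ} {α β : Type*} [Fintype β]
    (M : Matrix α β (MvPolynomial (Fin d × Fin n) F)) : ℕ :=
  ⨆ p : Fin d → Fin n → F, (evalMat M p).rank

/-- Partial evaluation: substitute `x_i := p_i` for `i ∈ S`, leaving the other
blocks of variables untouched. -/
noncomputable def pevalMat {d n : ℕ} {α β : Type*}
    (M : Matrix α β (MvPolynomial (Fin d × Fin n) F)) (S : Finset (Fin d))
    (p : Fin d → Fin n → F) :
    Matrix α β (MvPolynomial (Fin d × Fin n) F) :=
  M.map (aeval fun v : Fin d × Fin n => if v.1 ∈ S then C (p v.1 v.2) else X v)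

end Defs

section D1

variable {F : Type*} [Field F]

/-- Partition-rank decomposition for matrices of linear forms: a sum of `r` outer
products, each either (scalars) ⊗ (linear forms) or (linear forms) ⊗ (scalars). -/
def HasPR1Decomp {n a b : ℕ}
    (M : Matrix (Fin a) (Fin b) (MvPolynomial (Fin n) F)) (r : ℕ) : Prop :=
  ∃ (c : Fin r → Bool)
    (u : Fin r → Fin a → MvPolynomial (Fin n) F)
    (v : Fin r → Fin b → MvPolynomial (Fin n) F),
    (∀ t i, (u t i).IsHomogeneous (if c t then 0 else 1)) ∧
    (∀ t j, (v t j).IsHomogeneous (if c t then 1 else 0)) ∧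
    M = ∑ t, Matrix.of fun i j => u t i * v t j

/-- Partition rank of a matrix of linear forms. -/
noncomputable def PR1 {n a b : ℕ}
    (M : Matrix (Fin a) (Fin b) (MvPolynomial (Fin n) F)) : ℕ :=
  sInf {r | HasPR1Decomp M r}

/-- Max-rank of a matrix of linear forms. -/
noncomputable def MaxR1 {n a b : ℕ}
    (M : Matrix (Fin a) (Fin b) (MvPolynomial (Fin n) F)) : ℕ :=
  ⨆ p : Fin n → F, (M.map (eval p)).rank

end D1

section Tensor3

variable {F : Type*} [Field F]

/-- Substitute the first two blocks of variables of a trilinear form at `x` and `y`,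
leaving a polynomial in the third block. -/
noncomputable def sub01 {n : ℕ} (T : MvPolynomial (Fin 3 × Fin n) F)
    (x y : Fin n → F) : MvPolynomial (Fin 3 × Fin n) F :=
  aeval (fun v : Fin 3 × Fin n =>
    if v.1 = 0 then C (x v.2) else if v.1 = 1 then C (y v.2) else X v) T

open Classical in
/-- The bias of a 3-tensor: the probability over `(x, y)` that `T(x, y, -)` is the
zero linear form. -/
noncomputable def bias {n : ℕ} [Fintype F] (T : MvPolynomial (Fin 3 × Fin n) F) : ℝ :=
  ((Finset.univ.filter fun p : (Fin n → F) × (Fin n → F) =>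
      sub01 T p.1 p.2 = 0).card : ℝ) /
    ((Fintype.card ((Fin n → F) × (Fin n → F))) : ℝ)

/-- The analytic rank of a 3-tensor. -/
noncomputable def AR {n : ℕ} [Fintype F] (T : MvPolynomial (Fin 3 × Fin n) F) : ℝ :=
  - Real.logb (Fintype.card F) (bias T)

/-- A slice-rank decomposition: `T = ∑ f_t g_t` with `f_t` a linear form in one
block and `g_t` a bilinear form in the other two blocks. -/
def HasSRDecomp {n : ℕ} (T : MvPolynomial (Fin 3 × Fin n) F) (r : ℕ) : Prop :=
  ∃ (c : Fin r → Fin 3) (f g : Fin r → MvPolynomial (Fin 3 × Fin n) F),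
    (∀ t, IsMultilinearOn {c t} (f t)) ∧
    (∀ t, IsMultilinearOn ({c t} : Finset (Fin 3))ᶜ (g t)) ∧
    T = ∑ t, f t * g t

/-- Slice rank of a 3-tensor. -/
noncomputable def SR {n : ℕ} (T : MvPolynomial (Fin 3 × Fin n) F) : ℕ :=
  sInf {r | HasSRDecomp T r}

/-- The matrix `mat T` of a 3-tensor, evaluated at `x` in its first block:
the `(j,k)` entry is `T(x, e_j, e_k)`. -/
noncomputable def matT {n : ℕ} (T : MvPolynomial (Fin 3 × Fin n) F)
    (x : Fin n → F) : Matrix (Fin n) (Fin n) F :=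
  Matrix.of fun j k => eval (fun v : Fin 3 × Fin n =>
    if v.1 = 0 then x v.2
    else if v.1 = 1 then (if v.2 = j then 1 else 0)
    else (if v.2 = k then 1 else 0)) T

end Tensor3

section Mult

variable {F : Type*} [Field F]

/-- `mult(f, p)`: the minimum total degree of a monomial of `f(x + p)`. -/
noncomputable def polyMult {n : ℕ} (f : MvPolynomial (Fin n) F) (p : Fin n → F) : ℕ :=
  sInf {k | ∃ m ∈ (aeval (fun i : Fin n => X i + C (p i)) f :
    MvPolynomial (Fin n) F).support, (∑ i, m i) = k}

end Mult
universe u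


/-- rank over the fraction field -/
noncomputable def rkD {A : Type*} [CommRing A] [IsDomain A] {α β : Type*} [Fintype β]
    (N : Matrix α β A) : ℕ := (N.map (algebraMap A (FractionRing A))).rank

theorem exists_cols {K : Type*} [Field K] {α β : Type*} [Fintype α] [Fintype β]
    (N : Matrix α β K) (r : ℕ) (hr : N.rank = r) :
    ∃ J : Fin r → β, (N.submatrix id J).rank = r := by
  classical
  obtain ⟨κ, a, ha, hsp, hli⟩ := exists_linearIndependent' K N.col
  have : Finite κ := Finite.of_injective a ha
  have := Fintype.ofFinite κ
  have hc : Fintype.card κ = r := by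
    rw [← hr, Matrix.rank_eq_finrank_span_cols, ← hsp]
    exact (finrank_span_eq_card hli).symm
  let e : Fin r ≃ κ := (Fintype.equivFinOfCardEq hc).symm
  refine ⟨a ∘ e, ?_⟩
  rw [Matrix.rank_eq_finrank_span_cols]
  have h2 : LinearIndependent K ((N.col ∘ a) ∘ e) := hli.comp _ e.injective
  have := finrank_span_eq_card h2
  rw [Fintype.card_fin] at this
  exact this

theorem exists_sub {K : Type*} [Field K] {α β : Type*} [Fintype α] [Fintype β]
    (N : Matrix α β K) (r : ℕ) (hr : N.rank = r) : ∃ (I : Fin r → α) (J : Fin r → β),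
      (N.submatrix I J).det ≠ 0 := by
  classical
  obtain ⟨J, hJ⟩ := exists_cols N r hr
  obtain ⟨I, hI⟩ := exists_cols (N.submatrix id J).transpose r (by rw [Matrix.rank_transpose, hJ])
  refine ⟨I, J, ?_⟩
  have h3 : (N.submatrix I J).transpose.rank = r := hI
  rw [Matrix.rank_transpose] at h3
  have h4 : LinearIndependent K (N.submatrix I J).row := by
    rw [linearIndependent_iff_card_eq_finrank_span, Set.finrank, ← Matrix.rank_eq_finrank_span_row, h3,
      Fintype.card_fin]
  rw [Matrix.linearIndependent_rows_iff_isUnit, Matrix.isUnit_iff_isUnit_det] at h4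
  exact h4.ne_zero

section
set_option linter.unusedSectionVars false
variable {A : Type*} [CommRing A] [IsDomain A] {B : Type*} [CommRing B] [IsDomain B]
  {α β : Type*} [Fintype α] [Fintype β]

theorem rkD_sub (N : Matrix α β A) : ∃ (I : Fin (rkD N) → α) (J : Fin (rkD N) → β),
      (N.submatrix I J).det ≠ 0 := by
  obtain ⟨I, J, h⟩ := exists_sub _ (rkD N) (rfl : (N.map (algebraMap A (FractionRing A))).rank = _)
  refine ⟨I, J, fun h0 => h ?_⟩
  rw [Matrix.submatrix_map, ← RingHom.mapMatrix_apply, ← RingHom.map_det, h0, map_zero]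

theorem le_rkD (N : Matrix α β A) (r : ℕ) (I : Fin r → α) (J : Fin r → β)
    (h : (N.submatrix I J).det ≠ 0) : r ≤ rkD N := by
  have h1 : ((N.submatrix I J).map (algebraMap A (FractionRing A))).det ≠ 0 := by
    rw [← RingHom.mapMatrix_apply, ← RingHom.map_det]
    exact fun h0 => h (IsFractionRing.injective A (FractionRing A) (by rw [h0, map_zero]))
  have h2 := Matrix.rank_of_det_ne_zero h1
  rw [Fintype.card_fin] at h2
  rw [← h2, ← Matrix.submatrix_map]
  exact Matrix.rank_submatrix_le _ _ _

theorem rkD_map_le (φ : A →+* B) (N : Matrix α β A) : rkD (N.map φ) ≤ rkD N := by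
  obtain ⟨I, J, h⟩ := rkD_sub (N.map φ)
  refine le_rkD _ _ I J fun h0 => h ?_
  rw [Matrix.submatrix_map, ← RingHom.mapMatrix_apply, ← RingHom.map_det, h0, map_zero]

theorem rkD_field {K : Type*} [Field K] (N : Matrix α β K) : rkD N = N.rank := by
  apply le_antisymm
  · obtain ⟨I, J, h⟩ := rkD_sub N
    have := Matrix.rank_of_det_ne_zero h
    rw [Fintype.card_fin] at this
    calc _ = _ := this.symm
      _ ≤ _ := Matrix.rank_submatrix_le _ _ _
  · obtain ⟨I, J, h⟩ := exists_sub N _ rfl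
    exact le_rkD _ _ I J h

theorem rkD_map_frac (N : Matrix α β A) :
    (N.map (algebraMap A (FractionRing A))).rank = rkD N := rfl

theorem rkD_eq_zero (N : Matrix α β A) (h : rkD N = 0) : N = 0 := by
  ext i j
  by_contra h0
  have := le_rkD N 1 (fun _ => i) (fun _ => j) (by simpa [Matrix.det_fin_one] using h0)
  omega

theorem rkD_factor [IsPrincipalIdealRing A] (N : Matrix α β A) :
    ∃ (U : Matrix α (Fin (rkD N)) A) (V : Matrix (Fin (rkD N)) β A), N = U * V := by
  classical
  let W := Submodule.span A (Set.range N.col)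
  obtain ⟨k, b⟩ := Submodule.basisOfPid (Pi.basisFun A α) W
  let U : Matrix α (Fin k) A := Matrix.of fun i l => (b l : α → A) i
  let V : Matrix (Fin k) β A := Matrix.of fun l j =>
    b.repr ⟨N.col j, Submodule.subset_span ⟨j, rfl⟩⟩ l
  have hUV : N = U * V := by
    ext i j
    let w : W := ⟨N.col j, Submodule.subset_span ⟨j, rfl⟩⟩
    have h1 : ∑ l, b.repr w l • (b l : α → A) = N.col j := by
      have := congrArg (Submodule.subtype W) (b.sum_repr w)
      rw [map_sum] at this
      exact this
    have h2 := congrFun h1 i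
    rw [Finset.sum_apply] at h2
    rw [Matrix.mul_apply]
    refine h2.symm.trans (Finset.sum_congr rfl fun _ _ => ?_)
    exact mul_comm _ _
  have hZ : ∀ l, ∃ z : β → A, N.mulVec z = (b l : α → A) := by
    intro l
    have : (b l : α → A) ∈ Submodule.span A (Set.range N.col) := (b l).2
    rw [← Matrix.range_mulVecLin] at this
    obtain ⟨z, hz⟩ := this
    exact ⟨z, hz⟩
  choose z hz using hZ
  have hU : U = N * (Matrix.of fun j l => z l j) := by
    ext i l
    rw [Matrix.mul_apply]
    simp only [U, Matrix.of_apply]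
    rw [← hz l]; rfl
  let K := FractionRing A
  have hk : k ≤ rkD N := by
    have h1 : (U.map (algebraMap A K)).rank = k := by
      have hli : LinearIndependent A (fun l => (b l : α → A)) :=
        b.linearIndependent.map' W.subtype (Submodule.ker_subtype _)
      have hli2 : LinearIndependent A (fun l => fun i => algebraMap A K ((b l : α → A) i)) := by
        have := hli.map' (LinearMap.compLeft (Algebra.linearMap A K) α) (by
          rw [LinearMap.ker_eq_bot]
          intro x y hxy
          ext i
          exact IsFractionRing.injective A K (congrFun hxy i))
        exact this
      rw [LinearIndependent.iff_fractionRing A K] at hli2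
      rw [Matrix.rank_eq_finrank_span_cols]
      have := finrank_span_eq_card hli2
      rw [Fintype.card_fin] at this
      exact this
    rw [← h1, hU, Matrix.map_mul]
    exact Matrix.rank_mul_le_left _ _
  -- pad
  let s : Fin (rkD N) → Option (Fin k) := fun l => if h : l.1 < k then some ⟨l, h⟩ else none
  have key : ∃ k', k' = rkD N ∧ ∃ (U : Matrix α (Fin k') A) (V : Matrix (Fin k') β A), N = U * V := by
    obtain ⟨m, hm⟩ := Nat.exists_eq_add_of_le hk
    refine ⟨k + m, hm.symm, (Matrix.fromCols U (0 : Matrix α (Fin m) A)).submatrix id finSumFinEquiv.symm,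
      (Matrix.fromRows V (0 : Matrix (Fin m) β A)).submatrix finSumFinEquiv.symm id, ?_⟩
    rw [Matrix.submatrix_mul_equiv, Matrix.fromCols_mul_fromRows]
    simpa using hUV
  obtain ⟨k', rfl, h⟩ := key
  exact h

theorem rkD_coeff_one_field {K : Type*} [Field K] (N : Matrix α β (Polynomial K)) :
    rkD (N.map (fun f => f.coeff 1)) ≤ 2 * rkD N := by
  obtain ⟨U, V, h⟩ := rkD_factor N
  have : N.map (fun f => f.coeff 1) =
      Matrix.fromCols (U.map (fun f => f.coeff 0)) (U.map (fun f => f.coeff 1)) *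
      Matrix.fromRows (V.map (fun f => f.coeff 1)) (V.map (fun f => f.coeff 0)) := by
    ext i j
    conv_lhs => rw [h]
    rw [Matrix.fromCols_mul_fromRows]
    simp only [Matrix.map_apply, Matrix.mul_apply, Polynomial.finsetSum_coeff,
      Matrix.add_apply, ← Finset.sum_add_distrib]
    refine Finset.sum_congr rfl fun l _ => ?_
    rw [Polynomial.mul_coeff_one]
  rw [rkD_field, this]
  refine (Matrix.rank_mul_le_left _ _).trans ((Matrix.rank_le_card_width _).trans ?_)
  simp
  omega

theorem rkD_coeff_one (N : Matrix α β (Polynomial A)) :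
    rkD (N.map (fun f => f.coeff 1)) ≤ 2 * rkD N := by
  let K := FractionRing A
  have h := rkD_coeff_one_field (N.map (Polynomial.mapRingHom (algebraMap A K)))
  have e : (N.map (Polynomial.mapRingHom (algebraMap A K))).map (fun f => f.coeff 1) =
    (N.map (fun f => f.coeff 1)).map (algebraMap A K) := by
    ext i j; simp
  rw [e, rkD_field, rkD_map_frac] at h
  exact h.trans (Nat.mul_le_mul_left _ (rkD_map_le _ _))

theorem rank_schur {K : Type*} [Field K] (M N : Matrix α β K) (s : ℕ)
    (P : Matrix (Fin s) α K) (Q : Matrix β (Fin s) K) (Z : Matrix β β K)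
    (hA : (P * M * Q).det ≠ 0) (hN : N = M * Z) (hPN : P * N = 0) : N.rank + s ≤ M.rank := by
  classical
  let f : LinearMap.range M.mulVecLin →ₗ[K] (Fin s → K) := P.mulVecLin.domRestrict _
  have hf : LinearMap.range f = ⊤ := by
    rw [LinearMap.range_eq_top]
    intro y
    have hu : IsUnit (P * M * Q).det := hA.isUnit
    refine ⟨⟨M.mulVec (Q.mulVec ((P * M * Q)⁻¹.mulVec y)), ⟨_, rfl⟩⟩, ?_⟩
    change P.mulVec (M.mulVec (Q.mulVec ((P * M * Q)⁻¹.mulVec y))) = y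
    simp only [Matrix.mulVec_mulVec]
    rw [← Matrix.mul_assoc, ← Matrix.mul_assoc, Matrix.mul_nonsing_inv _ hu, Matrix.one_mulVec]
  have h1 := LinearMap.finrank_range_add_finrank_ker f
  rw [hf, finrank_top, Module.finrank_fin_fun] at h1
  have h2 : N.rank ≤ Module.finrank K (LinearMap.ker f) := by
    have hle : LinearMap.range N.mulVecLin ≤ (LinearMap.ker f).map (Submodule.subtype _) := by
      rintro _ ⟨x, rfl⟩
      refine ⟨⟨N.mulVec x, ⟨Z.mulVec x, ?_⟩⟩, ?_, rfl⟩
      · simp [hN]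
      · change P.mulVec (N.mulVec x) = 0
        rw [Matrix.mulVec_mulVec, hPN, Matrix.zero_mulVec]
    calc N.rank ≤ _ := Submodule.finrank_mono hle
      _ ≤ _ := Submodule.finrank_map_le _ _
  change _ ≤ Module.finrank K (LinearMap.range M.mulVecLin)
  omega

theorem rkD_schur (M N : Matrix α β A) (s : ℕ)
    (P : Matrix (Fin s) α A) (Q : Matrix β (Fin s) A) (Z : Matrix β β A)
    (hA : (P * M * Q).det ≠ 0) (hN : N = M * Z) (hPN : P * N = 0) : rkD N + s ≤ rkD M := by
  let φ := algebraMap A (FractionRing A)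
  refine rank_schur (M.map φ) (N.map φ) s (P.map φ) (Q.map φ) (Z.map φ) ?_ ?_ ?_
  · rw [← Matrix.map_mul, ← Matrix.map_mul, ← RingHom.mapMatrix_apply, ← RingHom.map_det]
    exact fun h0 => hA (IsFractionRing.injective A (FractionRing A) (by rw [map_zero]; exact h0))
  · rw [hN, Matrix.map_mul]
  · rw [← Matrix.map_mul, hPN]; ext; simp
end


/-- translation by `p` -/
noncomputable def shiftBy {F : Type*} [Field F] {σ : Type*} (p : σ → F) :
    MvPolynomial σ F →ₐ[F] MvPolynomial σ F := aeval (fun i => X i + C (p i))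

section
variable {F : Type*} [Field F]

theorem poly_mult (S : Finset F) (g : Polynomial F) (hS : S.Nonempty) :
    ∃ a : F, S.card * g.rootMultiplicity a ≤ g.natDegree := by
  classical
  by_contra! h
  have h1 : ∑ a ∈ S, g.rootMultiplicity a ≤ g.natDegree := by
    calc ∑ a ∈ S, g.rootMultiplicity a = ∑ a ∈ S, g.roots.count a := by simp
      _ ≤ Multiset.card g.roots := by
        refine le_trans ?_ (Multiset.toFinset_sum_count_eq g.roots).le
        rw [← Finset.sum_filter_add_sum_filter_not S (· ∈ g.roots.toFinset)]
        have : ∑ a ∈ S.filter (fun a => ¬ a ∈ g.roots.toFinset), g.roots.count a = 0 := by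
          refine Finset.sum_eq_zero fun a ha => ?_
          simp only [Finset.mem_filter, Multiset.mem_toFinset] at ha
          exact Multiset.count_eq_zero.mpr ha.2
        rw [this, add_zero]
        refine Finset.sum_le_sum_of_subset fun a ha => ?_
        exact (Finset.mem_filter.mp ha).2
      _ ≤ _ := g.card_roots'
  have h2 : ∑ a ∈ S, g.natDegree < ∑ a ∈ S, S.card * g.rootMultiplicity a :=
    Finset.sum_lt_sum_of_nonempty hS fun a _ => h a
  rw [Finset.sum_const, ← Finset.mul_sum, smul_eq_mul] at h2
  have := Nat.mul_le_mul_left S.card h1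
  omega

theorem finSucc_shift {n : ℕ} (p0 : F) (p : Fin n → F) (f : MvPolynomial (Fin (n+1)) F) :
    finSuccEquiv F n (shiftBy (Fin.cons p0 p) f) =
      ((finSuccEquiv F n f).map (shiftBy p).toRingHom).comp (Polynomial.X + Polynomial.C (C p0)) := by
  induction f using MvPolynomial.induction_on with
  | C a => simp [shiftBy, finSuccEquiv_apply, algebraMap_eq]
  | add f g hf hg => simp [hf, hg]
  | mul_X f i hf =>
    rw [map_mul (shiftBy _), map_mul (finSuccEquiv F n), hf, map_mul (finSuccEquiv F n),
      Polynomial.map_mul, Polynomial.mul_comp]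
    refine congrArg _ ?_
    refine Fin.cases ?_ (fun j => ?_) i
    · simp [shiftBy, finSuccEquiv_apply]
    · simp [shiftBy, finSuccEquiv_apply]

theorem coeff_comp_C {σ : Type*} (m : σ →₀ ℕ) (p0 : F) (G : Polynomial (MvPolynomial σ F))
    (g : Polynomial F) (hg : ∀ i, g.coeff i = coeff m (G.coeff i)) (k : ℕ) :
    coeff m ((G.comp (Polynomial.X + Polynomial.C (C p0))).coeff k) =
      (g.comp (Polynomial.X + Polynomial.C p0)).coeff k := by
  have hd : g.natDegree < G.natDegree + 1 := by
    rw [Nat.lt_succ_iff, Polynomial.natDegree_le_iff_coeff_eq_zero]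
    intro N hN
    rw [hg, Polynomial.coeff_eq_zero_of_natDegree_lt hN, coeff_zero]
  rw [Polynomial.comp, Polynomial.comp, Polynomial.eval₂_eq_sum_range' _ hd,
    Polynomial.eval₂_eq_sum_range, Polynomial.finsetSum_coeff, Polynomial.finsetSum_coeff,
    coeff_sum]
  refine Finset.sum_congr rfl fun i _ => ?_
  rw [Polynomial.coeff_C_mul, Polynomial.coeff_C_mul, Polynomial.coeff_X_add_C_pow,
    Polynomial.coeff_X_add_C_pow, hg, ← C_pow, ← map_natCast (C : F →+* MvPolynomial σ F), ← C_mul,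
    mul_comm, coeff_C_mul, mul_comm]

theorem mult_fin (S : Finset F) (hS : S.Nonempty) (n : ℕ) (f : MvPolynomial (Fin n) F)
    (hf : f ≠ 0) : ∃ (p : Fin n → F) (m : Fin n →₀ ℕ), coeff m (shiftBy p f) ≠ 0 ∧
      S.card * m.degree ≤ f.totalDegree := by
  classical
  induction n with
  | zero =>
    refine ⟨0, 0, ?_, by simp⟩
    obtain ⟨c, rfl⟩ := C_surjective (Fin 0) f
    simpa [shiftBy, algebraMap_eq] using hf
  | succ n ih =>
    set G := finSuccEquiv F n f with hG
    have hG0 : G ≠ 0 := by simpa [hG] using hf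
    have hlead : G.coeff G.natDegree ≠ 0 := by simpa using hG0
    obtain ⟨p, m, hm, hdeg⟩ := ih _ hlead
    have hle := totalDegree_coeff_finSuccEquiv_add_le f G.natDegree hlead
    let g : Polynomial F := ∑ i ∈ Finset.range (G.natDegree + 1),
      Polynomial.monomial i (coeff m (shiftBy p (G.coeff i)))
    have hgc : ∀ i, g.coeff i = coeff m ((G.map (shiftBy p).toRingHom).coeff i) := by
      intro i
      simp only [g, Polynomial.finsetSum_coeff, Polynomial.coeff_monomial, Finset.sum_ite_eq',
        Polynomial.coeff_map]
      split_ifs with h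
      · rfl
      · rw [Finset.mem_range, not_lt] at h
        rw [Polynomial.coeff_eq_zero_of_natDegree_lt (by omega)]
        simp
    have hgt : g.coeff G.natDegree ≠ 0 := by
      rw [hgc, Polynomial.coeff_map]; exact hm
    have hg0 : g ≠ 0 := fun h => hgt (by rw [h, Polynomial.coeff_zero])
    have hgd : g.natDegree ≤ G.natDegree := by
      rw [Polynomial.natDegree_le_iff_coeff_eq_zero]
      intro N hN
      rw [hgc, Polynomial.coeff_map, Polynomial.coeff_eq_zero_of_natDegree_lt hN]
      simp
    obtain ⟨p0, hp0⟩ := poly_mult S g hS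
    rw [Polynomial.rootMultiplicity_eq_natTrailingDegree] at hp0
    set k := (g.comp (Polynomial.X + Polynomial.C p0)).natTrailingDegree
    refine ⟨Fin.cons p0 p, m.cons k, ?_, ?_⟩
    · rw [← finSuccEquiv_coeff_coeff, finSucc_shift, coeff_comp_C m p0 _ g hgc]
      have : g.comp (Polynomial.X + Polynomial.C p0) ≠ 0 := by
        intro h0
        rw [Polynomial.comp_eq_zero_iff] at h0
        rcases h0 with h0 | ⟨_, h0⟩
        · exact hg0 h0
        · have := congrArg (fun q => q.coeff 1) h0
          simp at this
      exact Polynomial.trailingCoeff_nonzero_iff_nonzero.mpr this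
    · have : (m.cons k).degree = k + m.degree := by
        simp [Finsupp.degree_eq_sum, Fin.sum_univ_succ]
      rw [this, mul_add]
      rw [← hG] at hle
      omega

theorem mult_fintype {σ : Type*} [Fintype σ] (S : Finset F) (hS : S.Nonempty) (f : MvPolynomial σ F)
    (hf : f ≠ 0) : ∃ (p : σ → F) (m : σ →₀ ℕ), coeff m (shiftBy p f) ≠ 0 ∧
      S.card * m.degree ≤ f.totalDegree := by
  classical
  let e := Fintype.equivFin σ
  obtain ⟨p, m, hm, hd⟩ := mult_fin S hS _ (rename e f)
    (fun h => hf (rename_injective e e.injective (by rw [h, map_zero])))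
  have hsh : ∀ g : MvPolynomial σ F, shiftBy p (rename e g) = rename e (shiftBy (p ∘ e) g) := by
    intro g
    induction g using MvPolynomial.induction_on with
    | C a => simp [shiftBy, algebraMap_eq]
    | add f g hf hg => simp [hf, hg]
    | mul_X f i hf => rw [map_mul, map_mul, hf, map_mul, map_mul]; simp [shiftBy]
  refine ⟨p ∘ e, m.mapDomain e.symm, ?_, ?_⟩
  · rw [hsh] at hm
    have : m = (m.mapDomain e.symm).mapDomain e := by
      rw [← Finsupp.mapDomain_comp]; simp
    rw [this, coeff_rename_mapDomain e e.injective] at hm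
    exact hm
  · rw [Finsupp.degree_mapDomain]
    refine hd.trans (totalDegree_rename_le _ _)

theorem det_mem_pow {σ : Type*} {r : ℕ} (B : Matrix (Fin r) (Fin r) (MvPolynomial σ F)) (s : ℕ)
    (hs : (B.map constantCoeff).rank ≤ s) : B.det ∈ idealOfVars σ F ^ (r - s) := by
  classical
  let B0 : Matrix (Fin r) (Fin r) (MvPolynomial σ F) := (B.map constantCoeff).map C
  let B1 := B - B0
  have hB1 : ∀ i j, B1 i j ∈ idealOfVars σ F := by
    intro i j
    rw [← pow_one (idealOfVars σ F), mem_pow_idealOfVars_iff']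
    intro x hx
    have : x = 0 := (Finsupp.degree_eq_zero_iff x).mp (by omega)
    subst this
    simp [B1, B0, constantCoeff_eq]
  have hB : B = B0 + B1 := by simp [B1]
  have h := (Matrix.detRowAlternating (n := Fin r) (R := MvPolynomial σ F)).toMultilinearMap.map_add_univ
    B0 B1
  let D : Finset (Fin r) → Matrix (Fin r) (Fin r) (MvPolynomial σ F) := fun T => T.piecewise B0 B1
  have hD0 : ∀ T i, i ∈ T → D T i = B0 i := fun T i hi => Finset.piecewise_eq_of_mem _ _ _ hi
  have hD1 : ∀ T i, i ∉ T → D T i = B1 i := fun T i hi => Finset.piecewise_eq_of_notMem _ _ _ hi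
  have h' : B.det = ∑ T : Finset (Fin r), (D T).det := by
    conv_lhs => rw [hB]
    exact h
  rw [h']
  refine Ideal.sum_mem _ fun T _ => ?_
  by_cases hT : T.card ≤ s
  · have : (D T).det ∈ idealOfVars σ F ^ (r - T.card) := by
      rw [← Matrix.det_transpose, Matrix.det_apply]
      refine Ideal.sum_mem _ fun τ _ => ?_
      rw [Units.smul_def, zsmul_eq_mul]
      refine Ideal.mul_mem_left _ _ ?_
      rw [← Finset.prod_mul_prod_compl T]
      refine Ideal.mul_mem_left _ _ ?_
      have hc : r - T.card = Tᶜ.card := by rw [Finset.card_compl, Fintype.card_fin]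
      rw [hc, ← Finset.prod_const]
      refine Ideal.prod_mem_prod fun i hi => ?_
      rw [Finset.mem_compl] at hi
      rw [Matrix.transpose_apply, hD1 T i hi]
      exact hB1 _ _
    exact Ideal.pow_le_pow_right (by omega) this
  · have : (D T).det = 0 := by
      by_contra hne
      apply hT
      have hli : LinearIndependent (MvPolynomial σ F) (D T).row :=
        Matrix.linearIndependent_rows_of_det_ne_zero hne
      have h1 : LinearIndependent (MvPolynomial σ F) (fun i : T => B0.row i) := by
        have := hli.comp (fun i : T => (i : Fin r)) Subtype.val_injective
        have e : (D T).row ∘ (fun i : T => (i : Fin r)) = fun i : T => B0.row i := by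
          ext1 i
          exact hD0 T i i.2
        rwa [e] at this
      have h2 : LinearIndependent F (fun i : T => (B.map constantCoeff) i) := by
        rw [Fintype.linearIndependent_iff] at h1 ⊢
        intro g hg i
        have := h1 (fun i => C (g i)) (by
          ext1 j
          have := congrArg (C : F → MvPolynomial σ F) (congrFun hg j)
          simpa [B0, Finset.sum_apply] using this) i
        simpa using this
      have h3 := h2.rank_matrix (M := Matrix.of fun i : T => (B.map constantCoeff) i)
      have h4 := Matrix.rank_submatrix_le (B.map constantCoeff) (fun i : T => (i : Fin r)) id
      rw [Fintype.card_coe] at h3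
      calc _ = _ := h3.symm
        _ ≤ _ := h4
        _ ≤ _ := hs
    rw [this]
    exact Ideal.zero_mem _
end

section
set_option linter.unusedSectionVars false
variable {F : Type*} [Field F] {d n : ℕ}

/-- block weights -/
def bw (d n : ℕ) : Fin d × Fin n → (Fin d → ℕ) := fun v => Pi.single v.1 1

/-- indicator of `S` -/
def indS {d : ℕ} (S : Finset (Fin d)) : Fin d → ℕ := fun i => if i ∈ S then 1 else 0

theorem weight_bw (m : Fin d × Fin n →₀ ℕ) (i : Fin d) :
    Finsupp.weight (bw d n) m i = ∑ j, m (i, j) := by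
  classical
  rw [Finsupp.weight_apply, Finsupp.sum_fintype _ _ (by simp), Finset.sum_apply,
    Fintype.sum_prod_type]
  rw [Finset.sum_eq_single i]
  · simp [bw]
  · intro b _ hb
    simp [bw, hb.symm]
  · simp

/-- component multilinear in the blocks of `S` -/
noncomputable def compS (S : Finset (Fin d)) :
    MvPolynomial (Fin d × Fin n) F →ₗ[F] MvPolynomial (Fin d × Fin n) F :=
  weightedHomogeneousComponent (bw d n) (indS S)

theorem coeff_compS (S : Finset (Fin d)) (f : MvPolynomial (Fin d × Fin n) F) (m) :
    coeff m (compS S f) = if Finsupp.weight (bw d n) m = indS S then coeff m f else 0 := by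
  rw [compS, coeff_weightedHomogeneousComponent]

theorem compS_multi (S : Finset (Fin d)) (f : MvPolynomial (Fin d × Fin n) F) :
    IsMultilinearOn S (compS S f) := by
  intro m hm i
  rw [mem_support_iff, coeff_compS] at hm
  have : Finsupp.weight (bw d n) m = indS S := by
    by_contra h; simp [h] at hm
  rw [← weight_bw, this, indS]

theorem weight_of_multi {S : Finset (Fin d)} {f : MvPolynomial (Fin d × Fin n) F}
    (hf : IsMultilinearOn S f) {m} (hm : coeff m f ≠ 0) : Finsupp.weight (bw d n) m = indS S := by
  ext i
  rw [weight_bw, hf m (mem_support_iff.mpr hm) i, indS]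

theorem compS_of_multi {S : Finset (Fin d)} {f : MvPolynomial (Fin d × Fin n) F}
    (hf : IsMultilinearOn S f) : compS S f = f := by
  ext m
  rw [coeff_compS]
  split_ifs with h
  · rfl
  · by_contra h0
    exact h (weight_of_multi hf (fun h => h0 h.symm))

theorem degree_eq_weight (m : Fin d × Fin n →₀ ℕ) :
    m.degree = ∑ i, Finsupp.weight (bw d n) m i := by
  simp only [weight_bw]
  rw [Finsupp.degree_eq_sum, Fintype.sum_prod_type]

theorem compS_mul (f g : MvPolynomial (Fin d × Fin n) F) :
    compS Finset.univ (f * g) = ∑ S : Finset (Fin d), compS S f * compS Sᶜ g := by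
  classical
  induction f using MvPolynomial.induction_on' with
  | add p q hp hq => simp only [add_mul, map_add, hp, hq, Finset.sum_add_distrib]
  | monomial u a =>
  induction g using MvPolynomial.induction_on' with
  | add p q hp hq => simp only [mul_add, map_add, hp, hq, Finset.sum_add_distrib]
  | monomial v b =>
  have hmon : ∀ (S : Finset (Fin d)) (u : Fin d × Fin n →₀ ℕ) (a : F), compS S (monomial u a) =
      if Finsupp.weight (bw d n) u = indS S then monomial u a else 0 := by
    intro S u a
    ext m
    rw [coeff_compS]
    by_cases h : u = m
    · subst h; split_ifs <;> simp
    · split_ifs <;> simp [coeff_monomial, h]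
  simp only [hmon, monomial_mul]
  by_cases h : Finsupp.weight (bw d n) (u + v) = indS Finset.univ
  · rw [if_pos h]
    have h1 : ∀ i, Finsupp.weight (bw d n) u i + Finsupp.weight (bw d n) v i = 1 := by
      intro i
      rw [map_add] at h
      simpa [indS] using congrFun h i
    let S0 : Finset (Fin d) := Finset.univ.filter fun i => Finsupp.weight (bw d n) u i = 1
    have hS0 : Finsupp.weight (bw d n) u = indS S0 := by
      ext i
      have := h1 i
      simp only [indS, S0, Finset.mem_filter, Finset.mem_univ, true_and]
      split_ifs <;> omega
    have hS1 : Finsupp.weight (bw d n) v = indS S0ᶜ := by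
      ext i
      have := h1 i
      simp only [indS, S0, Finset.mem_compl, Finset.mem_filter, Finset.mem_univ, true_and]
      split_ifs <;> omega
    rw [Finset.sum_eq_single S0]
    · rw [if_pos hS0, if_pos hS1, monomial_mul]
    · intro S _ hS
      rw [if_neg, zero_mul]
      rw [hS0]
      intro he
      apply hS
      ext i
      have := congrFun he i
      simp only [indS] at this
      split_ifs at this <;> simp_all
    · simp
  · rw [if_neg h]
    symm
    refine Finset.sum_eq_zero fun S _ => ?_
    split_ifs with h1 h2
    · exfalso
      apply h
      rw [map_add, h1, h2]
      ext i
      simp only [indS, Pi.add_apply, Finset.mem_compl, Finset.mem_univ, if_true]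
      split_ifs <;> simp_all
    · simp
    · simp
    · simp

theorem degree_indS (m : Fin d × Fin n →₀ ℕ) (S : Finset (Fin d))
    (h : Finsupp.weight (bw d n) m = indS S) : m.degree ≤ d := by
  rw [degree_eq_weight, h]
  calc ∑ i, indS S i ≤ ∑ i : Fin d, 1 := Finset.sum_le_sum fun i _ => by
        unfold indS; split_ifs <;> omega
    _ = d := by simp

theorem degree_ind_univ (m : Fin d × Fin n →₀ ℕ)
    (h : Finsupp.weight (bw d n) m = indS Finset.univ) : m.degree = d := by
  rw [degree_eq_weight, h]
  simp [indS]

theorem compS_ideal (S : Finset (Fin d)) (f : MvPolynomial (Fin d × Fin n) F)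
    (hf : f ∈ idealOfVars (Fin d × Fin n) F ^ (d + 1)) : compS S f = 0 := by
  rw [mem_pow_idealOfVars_iff'] at hf
  ext m
  rw [coeff_compS, coeff_zero]
  split_ifs with h
  · exact hf m (by have := degree_indS m S h; omega)
  · rfl

theorem compS_univ_mul_one_add (δ f : MvPolynomial (Fin d × Fin n) F)
    (hδ : δ - 1 ∈ idealOfVars (Fin d × Fin n) F ^ (d + 1)) :
    compS Finset.univ (δ * f) = compS Finset.univ f := by
  have : δ * f = (δ - 1) * f + f := by ring
  rw [this, map_add, compS_ideal _ _ (Ideal.mul_mem_right _ _ hδ), zero_add]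

theorem exists_trunc_inv {σ : Type*} (D : MvPolynomial σ F) (hD : constantCoeff D = 1) (k : ℕ) :
    ∃ g, g * D - 1 ∈ idealOfVars σ F ^ k := by
  refine ⟨∑ i ∈ Finset.range k, (1 - D) ^ i, ?_⟩
  have h := geom_sum_mul_neg (1 - D) k
  rw [sub_sub_cancel] at h
  rw [h]
  have hy : 1 - D ∈ idealOfVars σ F := by
    rw [← pow_one (idealOfVars σ F), mem_pow_idealOfVars_iff']
    intro x hx
    have : x = 0 := (Finsupp.degree_eq_zero_iff x).mp (by omega)
    subst this
    rw [constantCoeff_eq] at hD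
    simp [hD]
  have := Ideal.pow_mem_pow hy k
  simpa using (Ideal.neg_mem_iff _).mpr this

theorem mul_deg_lt {σ : Type*} {f g : MvPolynomial σ F} {a b : ℕ}
    (hf : ∀ m, coeff m f ≠ 0 → m.degree < a) (hg : ∀ m, coeff m g ≠ 0 → m.degree ≤ b) :
    ∀ m, coeff m (f * g) ≠ 0 → m.degree < a + b := by
  classical
  intro m hm
  rw [coeff_mul] at hm
  obtain ⟨x, hx, hne⟩ := Finset.exists_ne_zero_of_sum_ne_zero hm
  rw [Finset.HasAntidiagonal.mem_antidiagonal] at hx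
  have h1 := hf x.1 (left_ne_zero_of_mul hne)
  have h2 := hg x.2 (right_ne_zero_of_mul hne)
  rw [← hx, map_add]
  omega

theorem shift_monomial {σ : Type*} (p : σ → F) (m : σ →₀ ℕ) :
    ∀ m', coeff m' (shiftBy p (monomial m (1:F)) - monomial m 1) ≠ 0 → m'.degree < m.degree := by
  classical
  have hadd : ∀ a b : σ →₀ ℕ,
      (∀ m', coeff m' (shiftBy p (monomial a (1:F)) - monomial a 1) ≠ 0 → m'.degree < a.degree) →
      (∀ m', coeff m' (shiftBy p (monomial b (1:F)) - monomial b 1) ≠ 0 → m'.degree < b.degree) →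
      (∀ m', coeff m' (shiftBy p (monomial (a + b) (1:F)) - monomial (a + b) 1) ≠ 0 →
        m'.degree < (a + b).degree) := by
    intro a b ha hb m' hm'
    have hmon : ∀ c : σ →₀ ℕ, ∀ x, coeff x (monomial c (1 : F)) ≠ 0 → x.degree ≤ c.degree := by
      intro c x hx
      rw [coeff_monomial] at hx
      by_cases h : c = x
      · rw [h]
      · simp [h] at hx
    have e : shiftBy p (monomial (a + b) (1:F)) - monomial (a + b) 1 =
        (shiftBy p (monomial a (1:F)) - monomial a 1) * (shiftBy p (monomial b (1:F)) - monomial b 1)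
        + (shiftBy p (monomial a (1:F)) - monomial a 1) * monomial b 1
        + (shiftBy p (monomial b (1:F)) - monomial b 1) * monomial a 1 := by
      have : (monomial (a + b) (1:F)) = monomial a 1 * monomial b 1 := by
        rw [monomial_mul, one_mul]
      rw [this, map_mul]
      ring
    rw [e, coeff_add, coeff_add] at hm'
    rw [map_add]
    by_contra hcon
    apply hm'
    have z1 := not_imp_comm.mp (mul_deg_lt ha (fun m h => (hb m h).le) m') hcon
    have z2 := not_imp_comm.mp (mul_deg_lt ha (hmon b) m') hcon
    have z3 := not_imp_comm.mp (mul_deg_lt hb (hmon a) m') (by omega)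
    rw [z1, z2, z3]; simp
  have hzero : ∀ m', coeff m' (shiftBy p (monomial (0 : σ →₀ ℕ) (1:F)) - monomial 0 1) ≠ 0 →
      m'.degree < (0 : σ →₀ ℕ).degree := by
    intro m' h
    rw [show monomial (0 : σ →₀ ℕ) (1:F) = 1 from rfl, map_one] at h
    simp at h
  induction m using Finsupp.induction_linear with
  | zero => exact hzero
  | add a b ha hb => exact hadd a b ha hb
  | single i k =>
    induction k with
    | zero => rw [Finsupp.single_zero]; exact hzero
    | succ k ih =>
      rw [Finsupp.single_add]
      refine hadd _ _ ih ?_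
      intro m' h
      have e : shiftBy p (monomial (Finsupp.single i 1) (1:F)) - monomial (Finsupp.single i 1) 1
          = C (p i) := by
        change shiftBy p (X i) - X i = _
        simp [shiftBy]
      rw [e, coeff_C] at h
      have : m' = 0 := by
        by_contra h0
        simp [Ne.symm h0] at h
      rw [this]
      simp

theorem compS_shift (p : Fin d × Fin n → F) (f : MvPolynomial (Fin d × Fin n) F)
    (hf : IsMultilinear f) : compS Finset.univ (shiftBy p f) = f := by
  classical
  have h : compS Finset.univ (shiftBy p f - f) = 0 := by
    ext m
    rw [coeff_compS, coeff_zero]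
    split_ifs with hw
    swap
    · rfl
    have hd := degree_ind_univ m hw
    have e : shiftBy p f - f = ∑ x ∈ f.support,
        C (coeff x f) * (shiftBy p (monomial x (1:F)) - monomial x 1) := by
      conv_lhs => rw [f.as_sum]
      rw [map_sum, ← Finset.sum_sub_distrib]
      refine Finset.sum_congr rfl fun x _ => ?_
      have : monomial x (coeff x f) = C (coeff x f) * monomial x 1 := by
        rw [C_mul_monomial, mul_one]
      rw [this, map_mul, mul_sub]
      congr 2
      exact (shiftBy p).commutes _
    rw [e, coeff_sum]
    refine Finset.sum_eq_zero fun x hx => ?_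
    rw [coeff_C_mul]
    have hx' := degree_ind_univ x (weight_of_multi hf (mem_support_iff.mp hx))
    by_contra hne
    have := shift_monomial p x m (right_ne_zero_of_mul hne)
    omega
  rw [map_sub, sub_eq_zero, compS_of_multi hf] at h
  exact h

/-- scale block `i` by a new variable -/
noncomputable def scaleB (i : Fin d) :
    MvPolynomial (Fin d × Fin n) F →ₐ[F] Polynomial (MvPolynomial (Fin d × Fin n) F) :=
  aeval fun v => Polynomial.C (X v) * (if v.1 = i then Polynomial.X else 1)

theorem scaleB_monomial (i : Fin d) (m : Fin d × Fin n →₀ ℕ) :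
    scaleB i (monomial m (1:F)) = Polynomial.C (monomial m 1) *
      Polynomial.X ^ (Finsupp.weight (bw d n) m i) := by
  classical
  have hadd : ∀ a b : Fin d × Fin n →₀ ℕ, (scaleB i (monomial a (1:F)) = Polynomial.C (monomial a 1) *
      Polynomial.X ^ (Finsupp.weight (bw d n) a i)) → (scaleB i (monomial b (1:F)) =
        Polynomial.C (monomial b 1) * Polynomial.X ^ (Finsupp.weight (bw d n) b i)) →
      (scaleB i (monomial (a + b) (1:F)) = Polynomial.C (monomial (a + b) 1) *
      Polynomial.X ^ (Finsupp.weight (bw d n) (a + b) i)) := by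
    intro a b ha hb
    have : (monomial (a + b) (1:F)) = monomial a 1 * monomial b 1 := by
        rw [monomial_mul, one_mul]
    rw [this, map_mul, ha, hb, map_add, Pi.add_apply, pow_add, Polynomial.C_mul]
    ring
  have hzero : scaleB i (monomial (0 : Fin d × Fin n →₀ ℕ) (1:F)) = Polynomial.C (monomial 0 1) *
      Polynomial.X ^ (Finsupp.weight (bw d n) (0 : Fin d × Fin n →₀ ℕ) i) := by
    rw [show monomial (0 : Fin d × Fin n →₀ ℕ) (1:F) = 1 from rfl, map_one]
    simp
  induction m using Finsupp.induction_linear with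
  | zero => exact hzero
  | add a b ha hb => exact hadd a b ha hb
  | single v k =>
    induction k with
    | zero => rw [Finsupp.single_zero]; exact hzero
    | succ k ih =>
      rw [Finsupp.single_add]
      refine hadd _ _ ih ?_
      change scaleB i (X v) = Polynomial.C (X v) * _
      rw [scaleB, aeval_X, Finsupp.weight_single, one_smul, bw]
      by_cases h : v.1 = i
      · subst h; simp
      · simp [h, Ne.symm h]

theorem scaleB_coeff (i : Fin d) (f : MvPolynomial (Fin d × Fin n) F) (m) :
    coeff m ((scaleB i f).coeff 1) = if (∑ j, m (i, j)) = 1 then coeff m f else 0 := by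
  classical
  rw [← weight_bw]
  induction f using MvPolynomial.induction_on' with
  | add p q hp hq =>
    rw [map_add, Polynomial.coeff_add, coeff_add, hp, hq, coeff_add]
    split_ifs <;> simp
  | monomial u a =>
    have : monomial u a = C a * monomial u 1 := by
      rw [C_mul_monomial, mul_one]
    have h2 : scaleB i (C a : MvPolynomial (Fin d × Fin n) F) = Polynomial.C (C a) :=
      (scaleB i).commutes _
    rw [this, map_mul, scaleB_monomial, h2, ← mul_assoc, ← Polynomial.C_mul, ← this,
      Polynomial.coeff_C_mul, Polynomial.coeff_X_pow]
    by_cases hum : u = m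
    · subst hum
      by_cases h : Finsupp.weight (bw d n) u i = 1
      · simp [h]
      · simp [h, Ne.symm h]
    · have h0 : coeff m (monomial u a) = 0 := by rw [coeff_monomial, if_neg hum]
      rw [h0]
      split_ifs <;> simp [h0]

theorem rkD_compS_aux {α β : Type*} [Fintype α] [Fintype β] (T : Finset (Fin d)) :
    ∃ L : MvPolynomial (Fin d × Fin n) F → MvPolynomial (Fin d × Fin n) F,
      (∀ f m, coeff m (L f) = if ∀ i ∈ T, (∑ j, m (i, j)) = 1 then coeff m f else 0) ∧
      ∀ N : Matrix α β (MvPolynomial (Fin d × Fin n) F), rkD (N.map L) ≤ 2 ^ T.card * rkD N := by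
  classical
  induction T using Finset.induction_on with
  | empty => exact ⟨id, by simp, by simp⟩
  | insert i T hi ih =>
    obtain ⟨L, hL, hr⟩ := ih
    refine ⟨fun f => (scaleB i (L f)).coeff 1, ?_, ?_⟩
    · intro f m
      rw [scaleB_coeff, hL]
      simp only [Finset.forall_mem_insert]
      split_ifs <;> simp_all
    · intro N
      rw [Finset.card_insert_of_notMem hi]
      have h1 := rkD_coeff_one ((N.map L).map (scaleB i).toRingHom)
      have h2 := rkD_map_le (scaleB i).toRingHom (N.map L)
      have h3 := hr N
      have e : N.map (fun f => (scaleB i (L f)).coeff 1) =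
        ((N.map L).map (scaleB i).toRingHom).map (fun f => f.coeff 1) := rfl
      rw [e, pow_succ, mul_comm (2 ^ T.card) 2, mul_assoc]
      omega

theorem rkD_compS {α β : Type*} [Fintype α] [Fintype β]
    (N : Matrix α β (MvPolynomial (Fin d × Fin n) F)) :
    rkD (N.map (compS Finset.univ)) ≤ 2 ^ d * rkD N := by
  obtain ⟨L, hL, hr⟩ := rkD_compS_aux (F := F) (n := n) (α := α) (β := β) (Finset.univ : Finset (Fin d))
  have : L = compS Finset.univ := by
    ext f m
    rw [hL, coeff_compS]
    refine if_congr ?_ rfl rfl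
    rw [funext_iff]
    simp [weight_bw, indS]
  have h := hr N
  rw [this] at h
  simpa using h
end

section
set_option linter.unusedSectionVars false
variable {F : Type*} [Field F] {d n a b : ℕ}

theorem hasPR_of_fintype {ι : Type*} [Fintype ι]
    (M : Matrix (Fin a) (Fin b) (MvPolynomial (Fin d × Fin n) F))
    (S : ι → Finset (Fin d)) (u : ι → Fin a → MvPolynomial (Fin d × Fin n) F)
    (v : ι → Fin b → MvPolynomial (Fin d × Fin n) F)
    (hu : ∀ t i, IsMultilinearOn (S t) (u t i)) (hv : ∀ t j, IsMultilinearOn (S t)ᶜ (v t j))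
    (hM : ∀ i j, M i j = ∑ t, u t i * v t j) : HasPRDecomp M (Fintype.card ι) := by
  let e := (Fintype.equivFin ι).symm
  refine ⟨S ∘ e, u ∘ e, v ∘ e, fun t i => hu _ _, fun t j => hv _ _, ?_⟩
  ext1 i j
  rw [hM, Matrix.sum_apply, ← e.sum_comp]
  rfl

theorem hasPR_add {M M' : Matrix (Fin a) (Fin b) (MvPolynomial (Fin d × Fin n) F)} {k k' : ℕ}
    (h : HasPRDecomp M k) (h' : HasPRDecomp M' k') : HasPRDecomp (M + M') (k + k') := by
  obtain ⟨S, u, v, hu, hv, hM⟩ := h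
  obtain ⟨S', u', v', hu', hv', hM'⟩ := h'
  have := hasPR_of_fintype (M + M') (Sum.elim S S') (Sum.elim u u') (Sum.elim v v')
    (by rintro (t | t) i <;> simp [hu, hu']) (by rintro (t | t) i <;> simp [hv, hv'])
    (by
      intro i j
      rw [Fintype.sum_sum_type, hM, hM']
      simp [Matrix.sum_apply])
  simpa using this

theorem exists_point (S : Finset F) (hS : (d + 1) * 2 ^ (d + 1) ≤ S.card)
    (M : Matrix (Fin a) (Fin b) (MvPolynomial (Fin d × Fin n) F))
    (hM : ∀ i j, IsMultilinear (M i j)) :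
    ∃ p : Fin d × Fin n → F,
      2 ^ (d + 1) * (rkD M - ((M.map (shiftBy p)).map constantCoeff).rank) ≤ rkD M := by
  classical
  obtain ⟨r, hr, I, J, hf⟩ : ∃ r, rkD M = r ∧ ∃ (I : Fin r → Fin a) (J : Fin r → Fin b),
      (M.submatrix I J).det ≠ 0 := ⟨_, rfl, rkD_sub M⟩
  have hSn : S.Nonempty := by
    rw [← Finset.card_pos]
    have : 0 < (d + 1) * 2 ^ (d + 1) := by positivity
    omega
  obtain ⟨p, m, hm, hdeg⟩ := mult_fintype S hSn _ hf
  refine ⟨p, ?_⟩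
  rw [hr]
  set s := ((M.map (shiftBy p)).map constantCoeff).rank
  have htd : (M.submatrix I J).det.totalDegree ≤ r * d := by
    have hh : (M.submatrix I J).det.IsHomogeneous (r * d) := by
      rw [Matrix.det_apply]
      refine IsHomogeneous.sum _ _ _ fun τ _ => ?_
      rw [Units.smul_def, zsmul_eq_mul]
      have h1 : (∏ i, M.submatrix I J (τ i) i).IsHomogeneous (∑ i : Fin r, d) := by
        refine IsHomogeneous.prod _ _ _ fun i _ => ?_
        intro x hx
        have := degree_ind_univ x (weight_of_multi (hM _ _) hx)
        rw [Finsupp.degree_eq_weight_one] at this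
        exact this
      have h2 : (((τ.sign : ℤ) : MvPolynomial (Fin d × Fin n) F)).IsHomogeneous 0 := by
        rw [← map_intCast (C : F →+* MvPolynomial (Fin d × Fin n) F)]
        exact isHomogeneous_C _ _
      have := h2.mul h1
      simpa using this
    exact hh.totalDegree_le
  have hdet := det_mem_pow ((M.submatrix I J).map (shiftBy p)) s
    (Matrix.rank_submatrix_le ((M.map (shiftBy p)).map constantCoeff) I J)
  have e : ((M.submatrix I J).map (shiftBy p)).det = shiftBy p (M.submatrix I J).det := by
    rw [AlgHom.map_det]; rfl
  rw [e, mem_pow_idealOfVars_iff'] at hdet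
  have hrs : r - s ≤ m.degree := by
    by_contra h
    exact hm (hdet m (by omega))
  have h1 : (d + 1) * 2 ^ (d + 1) * (r - s) ≤ (d + 1) * r := by
    calc _ ≤ S.card * m.degree := Nat.mul_le_mul hS hrs
      _ ≤ r * d := hdeg.trans htd
      _ ≤ (d + 1) * r := by rw [mul_comm]; exact Nat.mul_le_mul_right _ (by omega)
  rw [mul_assoc] at h1
  exact Nat.le_of_mul_le_mul_left h1 (by omega)

theorem schur_step (M : Matrix (Fin a) (Fin b) (MvPolynomial (Fin d × Fin n) F))
    (hM : ∀ i j, IsMultilinear (M i j)) (p : Fin d × Fin n → F) (s : ℕ)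
    (hs : ((M.map (shiftBy p)).map constantCoeff).rank = s) :
    ∃ M₁ M₂ : Matrix (Fin a) (Fin b) (MvPolynomial (Fin d × Fin n) F), M = M₁ + M₂ ∧
      HasPRDecomp M₁ (2 ^ d * s) ∧ (∀ i j, IsMultilinear (M₂ i j)) ∧
      rkD M₂ ≤ 2 ^ d * (rkD M - s) := by
  classical
  set Mt := M.map (shiftBy p) with hMt
  obtain ⟨I, J, hdet⟩ := exists_sub _ s hs
  set A0 := (Mt.map constantCoeff).submatrix I J with hA0
  let P : Matrix (Fin s) (Fin a) (MvPolynomial (Fin d × Fin n) F) := (1 : Matrix (Fin a) (Fin a) (MvPolynomial (Fin d × Fin n) F)).submatrix I id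
  let Q0 : Matrix (Fin b) (Fin s) (MvPolynomial (Fin d × Fin n) F) := (1 : Matrix (Fin b) (Fin b) (MvPolynomial (Fin d × Fin n) F)).submatrix id J
  let Z : Matrix (Fin s) (Fin s) (MvPolynomial (Fin d × Fin n) F) := (A0⁻¹).map C
  let Q : Matrix (Fin b) (Fin s) (MvPolynomial (Fin d × Fin n) F) := Q0 * Z
  let A := P * Mt * Q
  have hP : P * Mt = Mt.submatrix I id := by
    ext1 i j
    simp [P, Matrix.mul_apply, Matrix.one_apply]
  have hQ : Mt.submatrix I id * Q0 = Mt.submatrix I J := by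
    ext1 i j
    simp [Q0, Matrix.mul_apply, Matrix.one_apply]
  have hA : A = Mt.submatrix I J * Z := by
    simp only [A, Q]
    rw [hP, ← Matrix.mul_assoc, hQ]
  have hAc : A.map constantCoeff = 1 := by
    rw [hA, Matrix.map_mul]
    have e1 : Z.map constantCoeff = A0⁻¹ := by
      ext i j; simp [Z]
    have e2 : (Mt.submatrix I J).map constantCoeff = A0 := rfl
    rw [e1, e2, Matrix.mul_nonsing_inv _ hdet.isUnit]
  have hD : constantCoeff A.det = 1 := by
    rw [RingHom.map_det, RingHom.mapMatrix_apply, hAc, Matrix.det_one]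
  obtain ⟨g, hg⟩ := exists_trunc_inv A.det hD (d + 1)
  let δ := g * A.det
  let A' := g • A.adjugate
  have hAA' : A * A' = δ • (1 : Matrix (Fin s) (Fin s) (MvPolynomial (Fin d × Fin n) F)) := by
    simp only [A', δ]
    rw [Matrix.mul_smul, Matrix.mul_adjugate, smul_smul]
  let U := Mt * Q * A'
  let V := P * Mt
  let N := δ • Mt - U * V
  have hPN : P * N = 0 := by
    simp only [N, U, V]
    rw [Matrix.mul_sub, Matrix.mul_smul]
    have : P * (Mt * Q * A' * (P * Mt)) = (A * A') * (P * Mt) := by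
      simp only [A, Matrix.mul_assoc]
    rw [this, hAA', Matrix.smul_mul, Matrix.one_mul, sub_self]
  have hNZ : N = Mt * (δ • 1 - Q * A' * (P * Mt)) := by
    have e : Mt * (δ • (1 : Matrix (Fin b) (Fin b) (MvPolynomial (Fin d × Fin n) F))) = δ • Mt := by
      rw [Matrix.mul_smul, Matrix.mul_one]
    rw [Matrix.mul_sub, e]
    simp only [N, U, V, Matrix.mul_assoc]
  have hdne : (P * Mt * Q).det ≠ 0 := by
    intro h0
    change A.det = 0 at h0
    rw [h0] at hD
    simp at hD
  have hrk := rkD_schur Mt N s P Q _ hdne hNZ hPN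
  have hrk2 : rkD Mt ≤ rkD M := rkD_map_le (shiftBy p).toRingHom M
  refine ⟨M - N.map (compS Finset.univ), N.map (compS Finset.univ), by simp, ?_,
    fun i j => compS_multi _ _, ?_⟩
  · have := hasPR_of_fintype (ι := Finset (Fin d) × Fin s) (M - N.map (compS Finset.univ))
      (fun t => t.1) (fun t i => compS t.1 (U i t.2)) (fun t j => compS t.1ᶜ (V t.2 j))
      (fun t i => compS_multi _ _) (fun t j => compS_multi _ _) (by
        intro i j
        have e : N i j = δ * Mt i j - ∑ l, U i l * V l j := rfl
        rw [Matrix.sub_apply, Matrix.map_apply, e, map_sub, compS_univ_mul_one_add _ _ hg, hMt,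
          Matrix.map_apply, compS_shift p _ (hM i j), sub_sub_cancel, map_sum,
          Fintype.sum_prod_type, Finset.sum_comm]
        exact Finset.sum_congr rfl fun l _ => compS_mul _ _)
    simpa using this
  · refine (rkD_compS N).trans (Nat.mul_le_mul_left _ ?_)
    omega

theorem big_field (S : Finset F) (hS : (d + 1) * 2 ^ (d + 1) ≤ S.card) (r : ℕ) :
    ∀ M : Matrix (Fin a) (Fin b) (MvPolynomial (Fin d × Fin n) F),
    (∀ i j, IsMultilinear (M i j)) → rkD M = r →
    ∃ k, k ≤ 2 ^ (d + 1) * r ∧ HasPRDecomp M k := by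
  induction r using Nat.strong_induction_on with
  | _ r ih =>
  intro M hM hr
  rcases Nat.eq_zero_or_pos r with h0 | hpos
  · have hM0 := rkD_eq_zero M (by omega)
    refine ⟨0, by omega, Fin.elim0, Fin.elim0, Fin.elim0, fun t => t.elim0, fun t => t.elim0, ?_⟩
    simpa using hM0
  · obtain ⟨p, hp⟩ := exists_point S hS M hM
    set s := ((M.map (shiftBy p)).map constantCoeff).rank with hs
    obtain ⟨M₁, M₂, hsum, h1, hM2, h2⟩ := schur_step M hM p s hs.symm
    have hsr : s ≤ rkD M := by
      have e1 := rkD_map_le (constantCoeff : MvPolynomial (Fin d × Fin n) F →+* F) (M.map (shiftBy p))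
      have e2 := rkD_map_le (shiftBy p).toRingHom M
      rw [rkD_field] at e1
      exact e1.trans e2
    rw [hr] at hp h2 hsr
    have hpow : 2 ^ (d + 1) * (r - s) = 2 * (2 ^ d * (r - s)) := by rw [pow_succ]; ring
    obtain ⟨k, hk, hkd⟩ := ih (rkD M₂) (by omega) M₂ hM2 rfl
    refine ⟨2 ^ d * s + k, ?_, hsum ▸ hasPR_add h1 hkd⟩
    have e1 : 2 ^ d * s ≤ 2 ^ d * r := Nat.mul_le_mul_left _ hsr
    have e2 : k ≤ 2 ^ d * r := by
      calc k ≤ 2 ^ (d + 1) * rkD M₂ := hk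
        _ = 2 ^ d * (2 * rkD M₂) := by rw [pow_succ]; ring
        _ ≤ 2 ^ d * r := Nat.mul_le_mul_left _ (by omega)
    have e3 : 2 ^ (d + 1) * r = 2 ^ d * r + 2 ^ d * r := by rw [pow_succ]; ring
    omega

end

section
variable {F : Type*} [Field F] {K : Type*} [Field K] [Algebra F K]

/-- coefficientwise application of a linear functional -/
noncomputable def cmap {σ : Type*} (φ : K →ₗ[F] F) (f : MvPolynomial σ K) : MvPolynomial σ F :=
  ∑ m ∈ f.support, monomial m (φ (coeff m f))

theorem coeff_cmap {σ : Type*} (φ : K →ₗ[F] F) (f : MvPolynomial σ K) (m : σ →₀ ℕ) :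
    coeff m (cmap φ f) = φ (coeff m f) := by
  classical
  rw [cmap, coeff_sum]
  simp only [coeff_monomial]
  rw [Finset.sum_ite_eq']
  split_ifs with h
  · rfl
  · rw [notMem_support_iff.mp h, map_zero]

theorem cmap_multi {d n : ℕ} (φ : K →ₗ[F] F) (f : MvPolynomial (Fin d × Fin n) K)
    (S : Finset (Fin d)) (hf : IsMultilinearOn S f) : IsMultilinearOn S (cmap φ f) := by
  intro m hm
  refine hf m ?_
  rw [mem_support_iff] at hm ⊢
  rw [coeff_cmap] at hm
  exact fun h => hm (by rw [h, map_zero])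

theorem descent {d n a b k e : ℕ} (B : Module.Basis (Fin e) F K)
    (M : Matrix (Fin a) (Fin b) (MvPolynomial (Fin d × Fin n) F))
    (h : HasPRDecomp (M.map (map (algebraMap F K))) k) : HasPRDecomp M (k * e) := by
  classical
  obtain ⟨S, u, v, hu, hv, hM⟩ := h
  obtain ⟨φ, hφ⟩ := LinearMap.exists_leftInverse_of_injective (Algebra.linearMap F K)
    (LinearMap.ker_eq_bot.mpr (algebraMap F K).injective)
  have hφ' : ∀ c, φ (algebraMap F K c) = c := fun c => LinearMap.congr_fun hφ c
  have := hasPR_of_fintype (ι := Fin k × Fin e) M (fun t => S t.1)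
    (fun t i => cmap (B.coord t.2) (u t.1 i)) (fun t j => cmap φ (C (B t.2) * v t.1 j))
    (fun t i => cmap_multi _ _ _ (hu _ _))
    (fun t j => cmap_multi _ _ _ (by
      intro m hm
      refine hv t.1 j m ?_
      rw [mem_support_iff] at hm ⊢
      rw [coeff_C_mul] at hm
      exact right_ne_zero_of_mul hm))
    (by
      intro i j
      ext m
      have h1 := congrArg (fun X => φ (coeff m (X i j))) hM
      simp only [Matrix.map_apply, coeff_map, hφ', Matrix.sum_apply, Matrix.of_apply, coeff_sum,
        coeff_mul, map_sum] at h1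
      rw [h1, coeff_sum, Fintype.sum_prod_type]
      refine Finset.sum_congr rfl fun t _ => ?_
      have hl : ∀ l, coeff m (cmap (B.coord l) (u t i) * cmap φ (C (B l) * v t j)) =
          ∑ x ∈ Finset.HasAntidiagonal.antidiagonal m,
            B.repr (coeff x.1 (u t i)) l * φ (B l * coeff x.2 (v t j)) := by
        intro l
        rw [coeff_mul]
        refine Finset.sum_congr rfl fun x _ => ?_
        rw [coeff_cmap, coeff_cmap, coeff_C_mul]
        rfl
      simp only [hl]
      rw [Finset.sum_comm]
      refine Finset.sum_congr rfl fun x _ => ?_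
      conv_lhs => rw [← B.sum_repr (coeff x.1 (u t i)), Finset.sum_mul, map_sum]
      refine Finset.sum_congr rfl fun l _ => ?_
      rw [smul_mul_assoc, map_smul, smul_eq_mul])
  simpa using this
end


theorem finite_case {F : Type*} [Field F] [Finite F] {d n a b : ℕ}
    (M : Matrix (Fin a) (Fin b) (MvPolynomial (Fin d × Fin n) F))
    (hM : ∀ i j, IsMultilinear (M i j)) :
    ∃ k, k ≤ 2 ^ (d + 1) * (2 * d + 1) * rkD M ∧ HasPRDecomp M k := by
  classical
  obtain ⟨p, hp⟩ := CharP.exists F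
  have hpp : Fact p.Prime := ⟨CharP.char_is_prime F p⟩
  have : NeZero (2 * d + 1) := ⟨by omega⟩
  let K := FiniteField.Extension F p (2 * d + 1)
  have hcard : Nat.card K = Nat.card F ^ (2 * d + 1) := FiniteField.natCard_extension F p (2 * d + 1)
  have hfr : Module.finrank F K = 2 * d + 1 := FiniteField.finrank_extension F p (2 * d + 1)
  have : Finite K := Module.finite_of_finite F
  have := Fintype.ofFinite K
  let B : Module.Basis (Fin (2 * d + 1)) F K := Module.finBasisOfFinrankEq F K hfr
  have hS : (d + 1) * 2 ^ (d + 1) ≤ (Finset.univ : Finset K).card := by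
    rw [Finset.card_univ, ← Nat.card_eq_fintype_card, hcard]
    have h2 : 2 ≤ Nat.card F := Finite.one_lt_card
    calc (d + 1) * 2 ^ (d + 1) ≤ 2 ^ d * 2 ^ (d + 1) :=
          Nat.mul_le_mul_right _ (Nat.lt_two_pow_self)
      _ = 2 ^ (2 * d + 1) := by rw [← pow_add]; congr 1; omega
      _ ≤ _ := Nat.pow_le_pow_left h2 _
  obtain ⟨k, hk, hkd⟩ := big_field (F := K) Finset.univ hS _ (M.map (map (algebraMap F K))) (by
    intro i j m hm
    refine hM i j m ?_
    rw [mem_support_iff] at hm ⊢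
    intro h
    apply hm
    rw [Matrix.map_apply, coeff_map, h, map_zero]) rfl
  refine ⟨k * (2 * d + 1), ?_, descent B M hkd⟩
  have := rkD_map_le (map (algebraMap F K)) M
  calc k * (2 * d + 1) ≤ 2 ^ (d + 1) * rkD M * (2 * d + 1) :=
        Nat.mul_le_mul_right _ (hk.trans (Nat.mul_le_mul_left _ this))
    _ = _ := by ring


/-- For every `d ≥ 0` there is a constant `C_d` such that for every
field `F`, every `n ≥ 1`, and every matrix `M` of multilinear forms,
`PR(M) ≤ C_d · CR(M)`. -/
theorem statement_0 (d : ℕ) :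
    ∃ C : ℕ, ∀ (F : Type u) [Field F] (n a b : ℕ), 1 ≤ n →
      ∀ M : Matrix (Fin a) (Fin b) (MvPolynomial (Fin d × Fin n) F),
        (∀ i j, IsMultilinear (M i j)) → PR M ≤ C * CR M := by
  refine ⟨2 ^ (d + 1) * (2 * d + 1), ?_⟩
  intro F _ n a b _ M hM
  have key : ∃ k, k ≤ 2 ^ (d + 1) * (2 * d + 1) * rkD M ∧ HasPRDecomp M k := by
    rcases finite_or_infinite F with hF | hF
    · exact finite_case M hM
    · obtain ⟨S, hS⟩ := Infinite.exists_subset_card_eq F ((d + 1) * 2 ^ (d + 1))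
      obtain ⟨k, hk, hkd⟩ := big_field S hS.ge _ M hM rfl
      refine ⟨k, hk.trans (Nat.mul_le_mul_right _ ?_), hkd⟩
      exact Nat.le_mul_of_pos_right _ (by omega)
  obtain ⟨k, hk, hkd⟩ := key
  exact (Nat.sInf_le hkd).trans hk
end

section
/- Let F = F_q be a finite field and M an M_d-matrix over F_q. Then MaxR(M) ≥ E_{p ∈ (F_q^n)^d}[rank M(p)] ≥ (1 − 1/q)^d · CR(M), where the expectation is over a uniformly random p ∈ (F_q^n)^d. -/
open MvPolynomial

section Helpers


theorem s3_exists_rows' {K m n : Type*} [Field K] [Fintype m] [Fintype n] (A : Matrix m n K)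
    (r : ℕ) (hr : A.rank = r) :
    ∃ f : Fin r → m, LinearIndependent K (A.submatrix f id).row := by
  obtain ⟨v, hv, -, hli⟩ := Submodule.exists_fun_fin_finrank_span_eq K (Set.range A.row)
  have h : r = Module.finrank K (Submodule.span K (Set.range A.row)) := by
    rw [← hr, A.rank_eq_finrank_span_row]
  subst h
  choose f hf using hv
  refine ⟨f, ?_⟩
  have h2 : (A.submatrix f id).row = v := by
    funext i
    rw [← hf i]
    rfl
  rw [h2]
  exact hli

theorem s3_exists_minor {K m n : Type*} [Field K] [Fintype m] [Fintype n] (A : Matrix m n K)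
    (r : ℕ) (hr : A.rank = r) :
    ∃ (f : Fin r → m) (g : Fin r → n), (A.submatrix f g).det ≠ 0 := by
  obtain ⟨f, hf⟩ := s3_exists_rows' A r hr
  have h2 : (A.submatrix f id).transpose.rank = r := by
    rw [Matrix.rank_transpose, hf.rank_matrix, Fintype.card_fin]
  obtain ⟨g, hg⟩ := s3_exists_rows' _ r h2
  refine ⟨f, g, ?_⟩
  rw [Matrix.linearIndependent_rows_iff_isUnit, Matrix.isUnit_iff_isUnit_det] at hg
  rw [← Matrix.det_transpose]
  exact hg.ne_zero

theorem s3_det_mem {σ K : Type*} [Field K] (r : ℕ)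
    (N : Matrix (Fin r) (Fin r) (MvPolynomial σ K)) :
    N.det ∈ idealOfVars σ K ^ (r - (N.map (constantCoeff (R := K) (σ := σ))).rank) := by
  have hex := (N.map (constantCoeff (R := K) (σ := σ))).exists_rank_normal_form
  generalize (N.map (constantCoeff (R := K) (σ := σ))).rank = ρ at hex ⊢
  obtain ⟨V, U, e, hV, hU, h⟩ := hex
  set P := V.map (C (σ := σ)) * N * U.map (C (σ := σ)) with hP
  have hVd : IsUnit (V.map (C (σ := σ))).det := by
    rw [← RingHom.mapMatrix_apply, ← RingHom.map_det]
    exact ((Matrix.isUnit_iff_isUnit_det _).1 hV).map _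
  have hUd : IsUnit (U.map (C (σ := σ))).det := by
    rw [← RingHom.mapMatrix_apply, ← RingHom.map_det]
    exact ((Matrix.isUnit_iff_isUnit_det _).1 hU).map _
  have hPd : P.det = (V.map (C (σ := σ))).det * N.det * (U.map (C (σ := σ))).det := by
    rw [hP, Matrix.det_mul, Matrix.det_mul]
  have hPc : P.map (constantCoeff (R := K) (σ := σ)) =
      (Matrix.fromBlocks 1 0 0 0).submatrix e e := by
    rw [← h, hP, Matrix.map_mul, Matrix.map_mul]
    congr 2
    · ext i j; simp
    · ext i j; simp
  have key : P.det ∈ idealOfVars σ K ^ (r - ρ) := by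
    rw [← Matrix.det_submatrix_equiv_self e.symm P, ← Matrix.det_transpose, Matrix.det_apply]
    refine Ideal.sum_mem _ fun s _ => ?_
    rw [Units.smul_def]
    refine zsmul_mem ?_ _
    rw [Fintype.prod_sum_type]
    refine Ideal.mul_mem_left _ _ ?_
    have hc : (Finset.univ : Finset (Fin (Fintype.card (Fin r) - ρ))).card = r - ρ := by simp
    rw [← hc, ← Finset.prod_const]
    refine Ideal.prod_mem_prod fun i _ => ?_
    rw [← pow_one (idealOfVars σ K), mem_pow_idealOfVars_iff']
    intro x hx
    have hx0 : x = 0 := by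
      rw [← Finsupp.degree_eq_zero_iff]; omega
    subst hx0
    have := congrFun (congrFun hPc (e.symm (Sum.inr i))) (e.symm (s (Sum.inr i)))
    simp only [Matrix.map_apply, Matrix.submatrix_apply, Equiv.apply_symm_apply] at this
    simp only [Matrix.transpose_apply, Matrix.submatrix_apply]
    rw [← constantCoeff_eq, this]
    rcases s (Sum.inr i) with k | k <;> simp
  rw [hPd] at key
  have := (Ideal.mul_unit_mem_iff_mem _ hUd).1 key
  exact (Ideal.unit_mul_mem_iff_mem _ hVd).1 this

/-- translation of a polynomial by a point -/
noncomputable def s3shift {F R : Type*} [Field F] [CommRing R] [Algebra F R] {n : ℕ}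
    (p : Fin n → F) : MvPolynomial (Fin n) R →ₐ[R] MvPolynomial (Fin n) R :=
  aeval fun i => X i + C (algebraMap F R (p i))

theorem s3_shift_cons {F R : Type*} [Field F] [CommRing R] [Algebra F R] {n : ℕ}
    (c : F) (p : Fin n → F) (f : MvPolynomial (Fin (n + 1)) R) :
    finSuccEquiv R n (s3shift (Fin.cons c p : Fin (n + 1) → F) f) =
      Polynomial.taylor (C (algebraMap F R c))
        ((finSuccEquiv R n f).map ((s3shift p : _ →ₐ[R] MvPolynomial (Fin n) R) : _ →+* _)) := by
  induction f using MvPolynomial.induction_on with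
  | C a => simp [finSuccEquiv_apply, s3shift, Polynomial.taylor_C]
  | add f g hf hg => simp only [map_add, hf, hg, Polynomial.map_add]
  | mul_X f i hf =>
    have hX : finSuccEquiv R n (s3shift (Fin.cons c p : Fin (n + 1) → F) (X i)) =
      Polynomial.taylor (C (algebraMap F R c)) ((finSuccEquiv R n (X i)).map
        ((s3shift p : _ →ₐ[R] MvPolynomial (Fin n) R) : _ →+* _)) := by
      induction i using Fin.cases with
      | zero => simp [s3shift, finSuccEquiv_apply, Polynomial.taylor_X]
      | succ i => simp [s3shift, finSuccEquiv_apply, Polynomial.taylor_C]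
    rw [map_mul, map_mul, hf, hX, map_mul, Polynomial.map_mul, Polynomial.taylor_mul]

/-- take the coefficient of `m` in every coefficient -/
noncomputable def s3u {R : Type*} [CommRing R] {n : ℕ} (m : Fin n →₀ ℕ)
    (h : Polynomial (MvPolynomial (Fin n) R)) : Polynomial R :=
  ∑ j ∈ Finset.range (h.natDegree + 1), Polynomial.monomial j (coeff m (h.coeff j))

theorem s3u_coeff {R : Type*} [CommRing R] {n : ℕ} (m : Fin n →₀ ℕ)
    (h : Polynomial (MvPolynomial (Fin n) R)) (j : ℕ) :
    (s3u m h).coeff j = coeff m (h.coeff j) := by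
  simp only [s3u, Polynomial.finsetSum_coeff, Polynomial.coeff_monomial,
    Finset.sum_ite_eq', Finset.mem_range]
  split_ifs with hj
  · rfl
  · rw [Polynomial.coeff_eq_zero_of_natDegree_lt (by omega)]; simp

theorem s3u_natDegree {R : Type*} [CommRing R] {n : ℕ} (m : Fin n →₀ ℕ)
    (h : Polynomial (MvPolynomial (Fin n) R)) : (s3u m h).natDegree ≤ h.natDegree := by
  rw [Polynomial.natDegree_le_iff_coeff_eq_zero]
  intro N hN
  rw [s3u_coeff, Polynomial.coeff_eq_zero_of_natDegree_lt hN]; simp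

theorem s3u_taylor {R : Type*} [CommRing R] {n : ℕ} (m : Fin n →₀ ℕ) (c : R)
    (h : Polynomial (MvPolynomial (Fin n) R)) (k : ℕ) :
    coeff m ((Polynomial.taylor (C c) h).coeff k) = (Polynomial.taylor c (s3u m h)).coeff k := by
  have h1 : ∀ h : Polynomial (MvPolynomial (Fin n) R), ∀ N, h.natDegree < N →
      (Polynomial.taylor (C c) h).coeff k = ∑ j ∈ Finset.range N, h.coeff j *
        C ((j.choose k : R) * c ^ (j - k)) := by
    intro h N hN
    conv_lhs => rw [h.as_sum_range' N hN]
    simp only [map_sum, Polynomial.finsetSum_coeff]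
    refine Finset.sum_congr rfl fun j _ => ?_
    rw [Polynomial.taylor_coeff, Polynomial.hasseDeriv_monomial, Polynomial.eval_monomial]
    simp; ring
  have h2 : ∀ h : Polynomial R, ∀ N, h.natDegree < N →
      (Polynomial.taylor c h).coeff k = ∑ j ∈ Finset.range N, h.coeff j *
        ((j.choose k : R) * c ^ (j - k)) := by
    intro h N hN
    conv_lhs => rw [h.as_sum_range' N hN]
    simp only [map_sum, Polynomial.finsetSum_coeff]
    refine Finset.sum_congr rfl fun j _ => ?_
    rw [Polynomial.taylor_coeff, Polynomial.hasseDeriv_monomial, Polynomial.eval_monomial]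
    ring
  rw [h1 h _ (Nat.lt_succ_self _), h2 _ (h.natDegree + 1) (Nat.lt_succ_of_le (s3u_natDegree m h))]
  rw [coeff_sum]
  refine Finset.sum_congr rfl fun j _ => ?_
  rw [mul_comm, coeff_C_mul, s3u_coeff, mul_comm]

theorem s3_sum_rootMultiplicity {F R : Type*} [Field F] [Fintype F] [CommRing R] [IsDomain R]
    [Algebra F R] (u : Polynomial R) :
    ∑ c : F, u.rootMultiplicity (algebraMap F R c) ≤ u.natDegree := by
  classical
  refine le_trans ?_ u.card_roots'
  simp only [← Polynomial.count_roots]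
  have hinj := FaithfulSMul.algebraMap_injective F R
  rw [← Finset.sum_image (s := Finset.univ) (g := algebraMap F R)
    (f := fun x => u.roots.count x) (fun a _ b _ h => hinj h)]
  rw [← Multiset.sum_count_eq_card (s := Finset.univ.image (algebraMap F R) ∪ u.roots.toFinset)
    (m := u.roots) (fun a ha => by simp [Multiset.mem_toFinset.2 ha])]
  exact Finset.sum_le_sum_of_subset Finset.subset_union_left

theorem s3_taylor_ne {R : Type*} [CommRing R] [IsDomain R] (u : Polynomial R) (hu : u ≠ 0) (c : R) :
    (Polynomial.taylor c u).coeff (u.rootMultiplicity c) ≠ 0 := by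
  rw [Polynomial.rootMultiplicity_eq_natTrailingDegree, ← Polynomial.taylor_apply]
  have : Polynomial.taylor c u ≠ 0 := by
    rwa [Ne, Polynomial.taylor_eq_zero]
  exact Polynomial.trailingCoeff_nonzero_iff_nonzero.2 this

/-- Schwartz-Zippel with multiplicities -/
theorem s3_sz {F R : Type*} [Field F] [Fintype F] [CommRing R] [IsDomain R]
    [Algebra F R] (n : ℕ) (f : MvPolynomial (Fin n) R) (hf : f ≠ 0) :
    ∃ μ : (Fin n → F) → (Fin n →₀ ℕ), (∀ p, coeff (μ p) (s3shift p f) ≠ 0) ∧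
      Fintype.card F * ∑ p, (μ p).degree ≤ Fintype.card F ^ n * f.totalDegree := by
  induction n with
  | zero =>
    refine ⟨fun _ => 0, fun p => ?_, by simp⟩
    have h := eq_C_of_isEmpty f
    rw [h] at hf ⊢
    simpa [s3shift] using hf
  | succ n ih =>
    set g := finSuccEquiv R n f with hg
    have hg0 : g ≠ 0 := by simpa [hg] using hf
    have hl : g.coeff g.natDegree ≠ 0 := by simpa using hg0
    obtain ⟨μ, hμ, hs⟩ := ih _ hl
    have hdeg := totalDegree_coeff_finSuccEquiv_add_le f g.natDegree hl
    rw [← hg] at hdeg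
    let u : (Fin n → F) → Polynomial R := fun p =>
      s3u (μ p) (g.map ((s3shift p : _ →ₐ[R] MvPolynomial (Fin n) R) : _ →+* _))
    have hu0 : ∀ p, u p ≠ 0 := by
      intro p h
      apply hμ p
      have := congrArg (fun v => Polynomial.coeff v g.natDegree) h
      simpa only [u, s3u_coeff, Polynomial.coeff_map, Polynomial.coeff_zero, RingHom.coe_coe, coeff_zero] using this
    have hud : ∀ p, (u p).natDegree ≤ g.natDegree := fun p =>
      (s3u_natDegree _ _).trans Polynomial.natDegree_map_le
    refine ⟨fun p => Finsupp.cons ((u (Fin.tail p)).rootMultiplicity (algebraMap F R (p 0)))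
      (μ (Fin.tail p)), fun p => ?_, ?_⟩
    · rw [← finSuccEquiv_coeff_coeff]
      conv => enter [1, 2, 1, 2, 1]; rw [← Fin.cons_self_tail p]
      rw [s3_shift_cons, s3u_taylor]
      exact s3_taylor_ne _ (hu0 _) _
    · have hdc : ∀ (k : ℕ) (m : Fin n →₀ ℕ), (Finsupp.cons k m).degree = k + m.degree := by
        intro k m
        simp [Finsupp.degree_eq_sum, Fin.sum_univ_succ]
      simp only [hdc]
      rw [← (Fin.consEquiv (fun _ : Fin (n + 1) => F)).sum_comp, Fintype.sum_prod_type_right]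
      have ht : ∀ (c : F) (p : Fin n → F),
        Fin.tail (Fin.consEquiv (fun _ : Fin (n + 1) => F) (c, p)) = p := fun _ _ => rfl
      simp only [ht, Fin.consEquiv_apply, Fin.cons_zero, Finset.sum_add_distrib,
        Finset.sum_const, Finset.card_univ, smul_eq_mul]
      have h1 : ∑ p : Fin n → F, ∑ c : F, (u p).rootMultiplicity (algebraMap F R c) ≤
          Fintype.card F ^ n * g.natDegree := by
        calc _ ≤ ∑ p : Fin n → F, g.natDegree :=
              Finset.sum_le_sum fun p _ => (s3_sum_rootMultiplicity _).trans (hud p)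
          _ = _ := by simp
      rw [← Finset.mul_sum]
      calc _ ≤ Fintype.card F * (Fintype.card F ^ n * g.natDegree +
            Fintype.card F ^ n * (g.coeff g.natDegree).totalDegree) := by gcongr
        _ = Fintype.card F ^ (n + 1) * ((g.coeff g.natDegree).totalDegree + g.natDegree) := by ring
        _ ≤ _ := by gcongr

end Helpers

section Helpers2

theorem s3_minor {F R : Type*} [Field F] [CommRing R] [IsDomain R] [Algebra F R] {n r : ℕ}
    (N : Matrix (Fin r) (Fin r) (MvPolynomial (Fin n) R)) (p : Fin n → F) (m : Fin n →₀ ℕ)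
    (h : coeff m (s3shift p N.det) ≠ 0) :
    ∃ (s : ℕ) (f g : Fin s → Fin r), r ≤ s + m.degree ∧
      ((N.map (eval fun i => algebraMap F R (p i))).submatrix f g).det ≠ 0 := by
  let K := FractionRing R
  let θ : MvPolynomial (Fin n) R →+* MvPolynomial (Fin n) K :=
    (MvPolynomial.map (algebraMap R K)).comp
      ((s3shift p : _ →ₐ[R] MvPolynomial (Fin n) R) : _ →+* _)
  have hinj : Function.Injective (algebraMap R K) := IsFractionRing.injective R K
  have hθ : (constantCoeff (R := K) (σ := Fin n)).comp θ =
      (algebraMap R K).comp (eval fun i => algebraMap F R (p i)) := by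
    apply MvPolynomial.ringHom_ext
    · intro a; simp [θ, s3shift]
    · intro i; simp [θ, s3shift]
  have hA : (N.map θ).map (constantCoeff (R := K) (σ := Fin n)) =
      (N.map (eval fun i => algebraMap F R (p i))).map (algebraMap R K) := by
    ext i j
    exact RingHom.congr_fun hθ (N i j)
  have h1 := s3_det_mem r (N.map θ)
  rw [hA, mem_pow_idealOfVars_iff'] at h1
  have h2 : (N.map θ).det = θ N.det := by
    rw [RingHom.map_det]; rfl
  obtain ⟨s, hs⟩ : ∃ s, ((N.map (eval fun i => algebraMap F R (p i))).map
    (algebraMap R K)).rank = s := ⟨_, rfl⟩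
  obtain ⟨f, g, hfg⟩ := s3_exists_minor _ s hs
  rw [hs] at h1
  refine ⟨s, f, g, ?_, ?_⟩
  · by_contra hlt
    have := h1 m (by omega)
    rw [h2] at this
    simp only [θ, RingHom.comp_apply, coeff_map, RingHom.coe_coe] at this
    exact h (hinj (by rw [this, map_zero]))
  · intro h0
    apply hfg
    rw [Matrix.submatrix_map, ← RingHom.mapMatrix_apply, ← RingHom.map_det, h0, map_zero]

theorem s3_totalDegree_det {R : Type*} [CommRing R] {n r : ℕ}
    (N : Matrix (Fin r) (Fin r) (MvPolynomial (Fin n) R))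
    (hN : ∀ i j, (N i j).totalDegree ≤ 1) : N.det.totalDegree ≤ r := by
  rw [Matrix.det_apply]
  refine totalDegree_finsetSum_le fun s _ => ?_
  rw [Units.smul_def]
  refine (totalDegree_smul_le _ _).trans ?_
  refine (totalDegree_finsetProd _ _).trans ?_
  refine (Finset.sum_le_sum fun i _ => hN _ _).trans ?_
  simp

def s3E (d n : ℕ) : Fin (d + 1) × Fin n ≃ Fin n ⊕ (Fin d × Fin n) where
  toFun x := Fin.cases (motive := fun _ => Fin n ⊕ (Fin d × Fin n))
    (Sum.inl x.2) (fun i => Sum.inr (i, x.2)) x.1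
  invFun := Sum.elim (fun j => (0, j)) (fun x => (x.1.succ, x.2))
  left_inv := by
    rintro ⟨i, j⟩
    induction i using Fin.cases <;> simp
  right_inv := by
    rintro (j | ⟨i, j⟩) <;> simp

noncomputable def s3psi (F : Type*) [Field F] (d n : ℕ) :
    MvPolynomial (Fin (d + 1) × Fin n) F ≃ₐ[F]
      MvPolynomial (Fin n) (MvPolynomial (Fin d × Fin n) F) :=
  (renameEquiv F (s3E d n)).trans (sumAlgEquiv F _ _)

theorem s3psi_zero {F : Type*} [Field F] {d n : ℕ} (j : Fin n) :
    s3psi F d n (X (0, j)) = X j := by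
  simp [s3psi, s3E]

theorem s3psi_succ {F : Type*} [Field F] {d n : ℕ} (i : Fin d) (j : Fin n) :
    s3psi F d n (X (i.succ, j)) = C (X (i, j)) := by
  simp [s3psi, s3E]

theorem s3psi_C {F : Type*} [Field F] {d n : ℕ} (a : F) :
    s3psi F d n (C a) = C (C a) := by
  simp [s3psi]

theorem s3psi_eval {F : Type*} [Field F] {d n : ℕ} (p0 : Fin n → F) (p : Fin d → Fin n → F)
    (f : MvPolynomial (Fin (d + 1) × Fin n) F) :
    eval (fun v : Fin d × Fin n => p v.1 v.2) (eval (fun j => C (p0 j)) (s3psi F d n f)) =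
      eval (fun v : Fin (d + 1) × Fin n =>
        (Fin.cons p0 p : Fin (d + 1) → Fin n → F) v.1 v.2) f := by
  induction f using MvPolynomial.induction_on with
  | C a => simp [s3psi_C]
  | add f g hf hg => simp only [map_add, hf, hg]
  | mul_X f v hf =>
    obtain ⟨i, j⟩ := v
    rw [map_mul, map_mul, map_mul, map_mul, hf]
    induction i using Fin.cases with
    | zero => simp [s3psi_zero]
    | succ i => simp [s3psi_succ]

def s3BA {F : Type*} [Field F] {d n : ℕ} (f : MvPolynomial (Fin d × Fin n) F) : Prop :=
  ∀ m ∈ f.support, ∀ i : Fin d, ∑ j : Fin n, m (i, j) ≤ 1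

theorem s3BA_sum {F : Type*} [Field F] {d n : ℕ} {ι : Type*} (s : Finset ι)
    (f : ι → MvPolynomial (Fin d × Fin n) F) (h : ∀ k ∈ s, s3BA (f k)) :
    s3BA (∑ k ∈ s, f k) := by
  classical
  intro m hm i
  have := support_sum hm
  rw [Finset.mem_biUnion] at this
  obtain ⟨k, hk, hmk⟩ := this
  exact h k hk m hmk i

theorem s3psi_monomial {F : Type*} [Field F] {d n : ℕ} (m : Fin (d + 1) × Fin n →₀ ℕ) (c : F) :
    s3psi F d n (monomial m c) =
      C (monomial (Finsupp.equivFunOnFinite.symm fun v : Fin d × Fin n => m (v.1.succ, v.2)) c) *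
        ∏ j, X j ^ m (0, j) := by
  rw [monomial_eq, monomial_eq, Finsupp.prod_fintype _ _ (by simp),
    Finsupp.prod_fintype _ _ (by simp), map_mul, s3psi_C, map_prod, Fintype.prod_prod_type,
    Fin.prod_univ_succ]
  simp only [map_pow, s3psi_zero, s3psi_succ, map_mul, map_prod, Fintype.prod_prod_type,
    Finsupp.equivFunOnFinite_symm_apply_apply]
  ring

theorem s3psi_totalDegree {F : Type*} [Field F] {d n : ℕ}
    (f : MvPolynomial (Fin (d + 1) × Fin n) F) (hf : s3BA f) :
    (s3psi F d n f).totalDegree ≤ 1 := by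
  conv_lhs => rw [f.as_sum, map_sum]
  refine totalDegree_finsetSum_le fun m hm => ?_
  rw [s3psi_monomial]
  refine (totalDegree_mul _ _).trans ?_
  rw [totalDegree_C, zero_add]
  refine (totalDegree_finsetProd _ _).trans ?_
  refine le_trans (Finset.sum_le_sum fun j _ => ?_) (hf m hm 0)
  rw [totalDegree_X_pow]

theorem s3psi_BA {F : Type*} [Field F] {d n : ℕ} (p0 : Fin n → F)
    (f : MvPolynomial (Fin (d + 1) × Fin n) F) (hf : s3BA f) :
    s3BA (eval (fun j => C (p0 j)) (s3psi F d n f)) := by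
  rw [f.as_sum, map_sum, map_sum]
  refine s3BA_sum _ _ fun m hm => ?_
  rw [s3psi_monomial]
  simp only [map_mul, eval_C, map_prod, map_pow, eval_X]
  simp only [← map_pow, ← map_prod]
  rw [mul_comm, C_mul_monomial]
  intro m' hm' i
  have := support_monomial_subset hm'
  rw [Finset.mem_singleton] at this
  subst this
  simpa using hf m hm i.succ

theorem s3_main {F : Type*} [Field F] [Fintype F] (n d : ℕ) : ∀ (r : ℕ)
    (N : Matrix (Fin r) (Fin r) (MvPolynomial (Fin d × Fin n) F)),
    (∀ i j, s3BA (N i j)) → N.det ≠ 0 →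
    (1 - 1 / (Fintype.card F : ℝ)) ^ d * (Fintype.card (Fin d → Fin n → F) : ℝ) * (r : ℝ) ≤
      ∑ p : Fin d → Fin n → F, ((evalMat N p).rank : ℝ) := by
  have hq : (0 : ℝ) < Fintype.card F := by exact_mod_cast Fintype.card_pos
  have hq1 : 0 ≤ 1 - 1 / (Fintype.card F : ℝ) := by
    rw [sub_nonneg, div_le_one hq]
    exact_mod_cast Fintype.card_pos
  induction d with
  | zero =>
    intro r N _ hdet
    have hr : ∀ p, (evalMat N p).rank = r := by
      intro p
      have h1 : (evalMat N p).det ≠ 0 := by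
        rw [evalMat, ← RingHom.mapMatrix_apply, ← RingHom.map_det]
        rw [eq_C_of_isEmpty N.det] at hdet ⊢
        simpa using hdet
      rw [Matrix.rank_of_det_ne_zero h1, Fintype.card_fin]
    simp [hr]
  | succ d ih =>
    intro r N hN hdet
    have hd : (N.map (s3psi F d n)).det = s3psi F d n N.det := by
      rw [AlgEquiv.map_det]; rfl
    have hd0 : (N.map (s3psi F d n)).det ≠ 0 := by
      rw [hd]; simpa using hdet
    obtain ⟨μ, hμ, hs⟩ := s3_sz (F := F) n _ hd0
    have htd := s3_totalDegree_det (N.map (s3psi F d n))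
      (fun i j => s3psi_totalDegree _ (hN i j))
    have hmin := fun p0 => s3_minor (N.map (s3psi F d n)) p0 (μ p0) (hμ p0)
    choose s f g hsr hfg using hmin
    have hstep : ∀ p0 : Fin n → F,
        (1 - 1 / (Fintype.card F : ℝ)) ^ d * (Fintype.card (Fin d → Fin n → F) : ℝ) * (s p0 : ℝ) ≤
        ∑ p : Fin d → Fin n → F,
          ((evalMat N (Fin.cons p0 p : Fin (d + 1) → Fin n → F)).rank : ℝ) := by
      intro p0
      refine (ih (s p0) _ ?_ (hfg p0)).trans ?_
      · intro i j
        exact s3psi_BA p0 _ (hN _ _)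
      · refine Finset.sum_le_sum fun p _ => ?_
        have : evalMat ((((N.map (s3psi F d n)).map (eval fun i =>
            algebraMap F (MvPolynomial (Fin d × Fin n) F) (p0 i)))).submatrix (f p0) (g p0)) p =
            (evalMat N (Fin.cons p0 p : Fin (d + 1) → Fin n → F)).submatrix (f p0) (g p0) := by
          ext i j
          exact s3psi_eval p0 p _
        rw [this]
        exact_mod_cast Matrix.rank_submatrix_le _ _ _
    rw [← (Fin.consEquiv (fun _ : Fin (d + 1) => Fin n → F)).sum_comp, Fintype.sum_prod_type]
    refine le_trans ?_ (Finset.sum_le_sum fun p0 _ => hstep p0)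
    rw [← Finset.mul_sum]
    have hcard : (Fintype.card (Fin (d + 1) → Fin n → F) : ℝ) =
        (Fintype.card F : ℝ) ^ n * (Fintype.card (Fin d → Fin n → F) : ℝ) := by
      simp [pow_succ, mul_comm]
    have hsum : (1 - 1 / (Fintype.card F : ℝ)) * (Fintype.card F : ℝ) ^ n * r ≤
        ∑ p0, (s p0 : ℝ) := by
      have h1 : (Fintype.card F : ℝ) ^ n * r ≤ ∑ p0, (s p0 : ℝ) + ∑ p0, ((μ p0).degree : ℝ) := by
        rw [← Finset.sum_add_distrib]
        have : ∑ p0 : Fin n → F, (r : ℝ) ≤ ∑ p0, ((s p0 : ℝ) + ((μ p0).degree : ℝ)) :=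
          Finset.sum_le_sum fun p0 _ => by exact_mod_cast hsr p0
        simpa using this
      have h2 : (Fintype.card F : ℝ) * ∑ p0, ((μ p0).degree : ℝ) ≤ (Fintype.card F : ℝ) ^ n * r := by
        have := hs.trans (Nat.mul_le_mul_left _ htd)
        exact_mod_cast this
      have h3 : ∑ p0, ((μ p0).degree : ℝ) ≤ 1 / (Fintype.card F : ℝ) *
          ((Fintype.card F : ℝ) ^ n * r) := by
        rw [one_div, ← div_eq_inv_mul, le_div_iff₀ hq]
        linarith
      linarith
    rw [hcard]
    calc _ = (1 - 1 / (Fintype.card F : ℝ)) ^ d * (Fintype.card (Fin d → Fin n → F) : ℝ) *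
          ((1 - 1 / (Fintype.card F : ℝ)) * (Fintype.card F : ℝ) ^ n * r) := by ring
      _ ≤ _ := mul_le_mul_of_nonneg_left hsum (by positivity)

end Helpers2

/-- Over `F_q`, `MaxR(M) ≥ E_p[rank M(p)] ≥ (1 − 1/q)^d · CR(M)`. -/
theorem statement_3 (F : Type*) [Field F] [Fintype F] (d n a b : ℕ) (hn : 1 ≤ n)
    (M : Matrix (Fin a) (Fin b) (MvPolynomial (Fin d × Fin n) F))
    (hM : ∀ i j, IsMultilinear (M i j)) :
    (∑ p : Fin d → Fin n → F, ((evalMat M p).rank : ℝ)) /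
        (Fintype.card (Fin d → Fin n → F) : ℝ) ≤ (MaxR M : ℝ) ∧
    (1 - 1 / (Fintype.card F : ℝ)) ^ d * (CR M : ℝ) ≤
      (∑ p : Fin d → Fin n → F, ((evalMat M p).rank : ℝ)) /
        (Fintype.card (Fin d → Fin n → F) : ℝ) := by
  have hc : (0 : ℝ) < (Fintype.card (Fin d → Fin n → F) : ℝ) := by
    exact_mod_cast Fintype.card_pos
  constructor
  · rw [div_le_iff₀ hc]
    have : ∑ p : Fin d → Fin n → F, ((evalMat M p).rank : ℝ) ≤
        ∑ p : Fin d → Fin n → F, (MaxR M : ℝ) := by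
      refine Finset.sum_le_sum fun p _ => ?_
      have h : (evalMat M p).rank ≤ MaxR M :=
        le_ciSup (f := fun p => (evalMat M p).rank) (Set.finite_range _).bddAbove p
      exact_mod_cast h
    refine this.trans ?_
    rw [Finset.sum_const, Finset.card_univ, nsmul_eq_mul, mul_comm]
  · rw [le_div_iff₀ hc]
    obtain ⟨r, hr⟩ : ∃ r, CR M = r := ⟨_, rfl⟩
    obtain ⟨f, g, hfg⟩ := s3_exists_minor _ r hr
    rw [hr]
    have hdet : (M.submatrix f g).det ≠ 0 := by
      intro h0
      apply hfg
      rw [Matrix.submatrix_map, ← RingHom.mapMatrix_apply, ← RingHom.map_det, h0, map_zero]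
    have h := s3_main n d r (M.submatrix f g) (fun i j m hm k => by
      have := hM (f i) (g j) m hm k
      simp at this
      exact this.le) hdet
    rw [mul_right_comm]
    refine h.trans (Finset.sum_le_sum fun p _ => ?_)
    have h2 : evalMat (M.submatrix f g) p = (evalMat M p).submatrix f g := rfl
    have h3 : (evalMat (M.submatrix f g) p).rank ≤ (evalMat M p).rank := by
      rw [h2]
      exact Matrix.rank_submatrix_le (evalMat M p) f g
    exact Nat.cast_le.2 h3
end
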